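/- arXiv:1805.10791 — 4 statements merged into one kernel-verified Lean document; each statement's English description precedes it below -/
import Mathlib

section
/- Let d, s be integers with 1 ≤ s ≤ d and s² ≤ 4d, let ε > 0 and γ > 0. Set α_γ = E(|ξ|^γ 1_{ξ² > 2 log(1+d/s²)}) / P(ξ² > 2 log(1+d/s²)) where ξ ~ N(0,1), and define the estimator N̂*_γ = Σ_{i=1}^d (|y_i|^γ − ε^γ α_γ) · 1_{y_i² > 2ε² log(1+d/s²)} based on observations y_i = θ_i + ε ξ_i with ξ_1,…,ξ_d i.i.d. N(0,1). Then there exists a constant C > 0 depending only on γ such that for every θ ∈ B_0(s), E_θ[(N̂*_γ − N_γ(θ))²] ≤ C ( ε^{2γ} s² (log(1+d/s²))^γ + ε² s^{2/γ} ‖θ‖_γ^{2γ−2} · 1_{γ>1} ). -/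
open MeasureTheory ProbabilityTheory Real

lemma rpow_sub_rpow_le_mul_rpow_sub_one {p a b : ℝ} (hp : 1 ≤ p) (ha : 0 ≤ a) (hab : a ≤ b) :
    b ^ p - a ^ p ≤ p * b ^ (p - 1) * (b - a) := by
  rcases (ha.trans hab).eq_or_lt with hb | hb
  · obtain rfl : a = b := le_antisymm hab (hb ▸ ha)
    simp
  have h := one_add_mul_self_le_rpow_one_add (s := a / b - 1) (by
    have := div_nonneg ha hb.le
    linarith) hp
  rw [add_sub_cancel, div_rpow ha hb.le, le_div_iff₀ (by positivity)] at h
  have h2 : b ^ p = b ^ (p - 1) * b := by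
    rw [rpow_sub_one hb.ne', div_mul_cancel₀ _ hb.ne']
  have h3 : (1 + p * (a / b - 1)) * b ^ p = b ^ p - p * b ^ (p - 1) * (b - a) := by
    rw [h2]
    field_simp
    ring
  linarith

lemma add_rpow_le_two_rpow_mul {p a b : ℝ} (hp : 0 ≤ p) (ha : 0 ≤ a) (hb : 0 ≤ b) :
    (a + b) ^ p ≤ 2 ^ p * (a ^ p + b ^ p) := by
  have hmax : (a + b) ^ p ≤ (2 * max a b) ^ p := by
    apply rpow_le_rpow (by positivity) _ hp
    linarith [le_max_left a b, le_max_right a b]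
  rw [mul_rpow (by norm_num) (le_max_of_le_left ha)] at hmax
  refine hmax.trans ?_
  gcongr
  have := rpow_nonneg ha p
  have := rpow_nonneg hb p
  rcases max_cases a b with h | h <;> rw [h.1] <;> linarith

lemma rpow_le_rpow_add_mul_rpow {γ a b t w : ℝ} (hγ : 0 < γ) (ha : 0 ≤ a) (hab : a ≤ b)
    (ht : 0 ≤ t) (hbt : b ≤ t + w) (hbw : b - a ≤ w) :
    b ^ γ - a ^ γ ≤
      (γ * 2 ^ γ + 1) * (w ^ γ + w * t ^ (γ - 1) * (if 1 < γ then 1 else 0)) := by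
  have hw : 0 ≤ w := by linarith
  split_ifs with h
  · have h1 := rpow_sub_rpow_le_mul_rpow_sub_one h.le ha hab
    have h2 : b ^ (γ - 1) ≤ 2 ^ γ * (t ^ (γ - 1) + w ^ (γ - 1)) := by
      calc b ^ (γ - 1) ≤ (t + w) ^ (γ - 1) :=
            rpow_le_rpow (ha.trans hab) hbt (by linarith)
        _ ≤ 2 ^ (γ - 1) * (t ^ (γ - 1) + w ^ (γ - 1)) :=
            add_rpow_le_two_rpow_mul (by linarith) ht hw
        _ ≤ _ := by
            gcongr
            · norm_num
            · linarith
    have h3 : w ^ (γ - 1) * w = w ^ γ := by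
      conv_rhs => rw [← sub_add_cancel γ 1]
      rw [rpow_add_one' hw (by simpa using hγ.ne')]
    calc b ^ γ - a ^ γ ≤ γ * b ^ (γ - 1) * (b - a) := h1
      _ ≤ γ * (2 ^ γ * (t ^ (γ - 1) + w ^ (γ - 1))) * w := by
          gcongr
      _ = γ * 2 ^ γ * (w ^ γ + w * t ^ (γ - 1) * 1) := by rw [← h3]; ring
      _ ≤ _ := by
          gcongr
          linarith
  · have h1 : b ^ γ ≤ a ^ γ + w ^ γ :=
      (rpow_le_rpow (ha.trans hab) (by linarith) hγ.le).trans
        (rpow_add_le_add_rpow ha hw hγ.le (not_lt.1 h))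
    have h2 : 0 ≤ γ * 2 ^ γ * w ^ γ := by positivity
    nlinarith

lemma abs_rpow_sub_rpow_le {γ u t w : ℝ} (hγ : 0 < γ) (hu : 0 ≤ u) (ht : 0 ≤ t)
    (hw : |u - t| ≤ w) :
    |u ^ γ - t ^ γ| ≤
      (γ * 2 ^ γ + 1) * (w ^ γ + w * t ^ (γ - 1) * (if 1 < γ then 1 else 0)) := by
  have hw' := abs_le.1 hw
  rcases le_total u t with h | h
  · rw [abs_sub_comm, abs_of_nonneg (sub_nonneg.2 (rpow_le_rpow hu h hγ.le))]
    exact rpow_le_rpow_add_mul_rpow hγ hu h ht (by linarith) (by linarith)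
  · rw [abs_of_nonneg (sub_nonneg.2 (rpow_le_rpow ht h hγ.le))]
    exact rpow_le_rpow_add_mul_rpow hγ ht h ht (by linarith) (by linarith)

lemma one_add_two_mul_abs_rpow_le {p : ℝ} (hp : 0 ≤ p) (x : ℝ) :
    (1 + 2 * |x|) ^ p ≤ exp (8 * p ^ 2) * exp (x ^ 2 / 8) := by
  calc (1 + 2 * |x|) ^ p ≤ (exp (2 * |x|)) ^ p := by
        apply rpow_le_rpow (by positivity) _ hp
        linarith [add_one_le_exp (2 * |x|)]
    _ = exp (2 * |x| * p) := by rw [← exp_mul]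
    _ ≤ exp (8 * p ^ 2 + x ^ 2 / 8) := by
        apply exp_le_exp.2
        rw [← sq_abs x]
        nlinarith [sq_nonneg (|x| - 8 * p)]
    _ = _ := exp_add _ _

lemma gaussianPDFReal_zero_one (x : ℝ) :
    gaussianPDFReal 0 1 x = (√(2 * π))⁻¹ * exp (-x ^ 2 / 2) := by
  simp [gaussianPDFReal]

lemma integrable_gaussianReal_zero_one_iff {f : ℝ → ℝ} :
    Integrable f (gaussianReal 0 1) ↔ Integrable (fun x => gaussianPDFReal 0 1 x * f x) := by
  rw [gaussianReal_of_var_ne_zero _ one_ne_zero, integrable_withDensity_iff_integrable_smul']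
  · simp [toReal_gaussianPDF]
  · exact measurable_gaussianPDF 0 1
  · exact ae_of_all _ fun _ => gaussianPDF_lt_top

lemma integrable_exp_mul_sq_gaussianReal {c : ℝ} (hc : c < 1 / 2) :
    Integrable (fun x : ℝ => exp (c * x ^ 2)) (gaussianReal 0 1) := by
  rw [integrable_gaussianReal_zero_one_iff]
  have h := (integrable_exp_neg_mul_sq (b := 1 / 2 - c) (by linarith)).const_mul (√(2 * π))⁻¹
  refine h.congr (ae_of_all _ fun x => ?_)
  simp only [gaussianPDFReal_zero_one, mul_assoc, ← exp_add]
  ring_nf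

lemma integrable_one_add_two_mul_abs_rpow {p : ℝ} (hp : 0 ≤ p) :
    Integrable (fun x : ℝ => (1 + 2 * |x|) ^ p) (gaussianReal 0 1) := by
  refine ((integrable_exp_mul_sq_gaussianReal (c := 1 / 8) (by norm_num)).const_mul
    (exp (8 * p ^ 2))).mono' (by fun_prop) (ae_of_all _ fun x => ?_)
  rw [norm_of_nonneg (by positivity)]
  convert one_add_two_mul_abs_rpow_le hp x using 3
  ring

lemma abs_rpow_le_one_add_two_mul_abs_rpow {p : ℝ} (hp : 0 ≤ p) (x : ℝ) :
    |x| ^ p ≤ (1 + 2 * |x|) ^ p :=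
  rpow_le_rpow (abs_nonneg x) (by linarith [abs_nonneg x]) hp

lemma integrable_abs_rpow_gaussianReal {p : ℝ} (hp : 0 ≤ p) :
    Integrable (fun x : ℝ => |x| ^ p) (gaussianReal 0 1) := by
  refine (integrable_one_add_two_mul_abs_rpow hp).mono' (by fun_prop) (ae_of_all _ fun x => ?_)
  rw [norm_of_nonneg (by positivity)]
  exact abs_rpow_le_one_add_two_mul_abs_rpow hp x

lemma measurableSet_lt_sq (a : ℝ) : MeasurableSet {x : ℝ | a < x ^ 2} :=
  measurableSet_lt measurable_const (by fun_prop)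

lemma exp_neg_two_mul_sq_le_gaussianReal_lt_sq {τ : ℝ} (hτ : 1 / 2 ≤ τ) :
    (2 * √(2 * π))⁻¹ * exp (-2 * τ ^ 2) ≤ (gaussianReal 0 1).real {x : ℝ | τ ^ 2 < x ^ 2} := by
  have hsub : Set.Ioo τ (2 * τ) ⊆ {x : ℝ | τ ^ 2 < x ^ 2} := fun x hx => by
    have := hx.1
    simp only [Set.mem_ofPred_eq]
    nlinarith
  refine le_trans ?_ (measureReal_mono hsub)
  rw [measureReal_def, gaussianReal_apply_eq_integral _ one_ne_zero,
    ENNReal.toReal_ofReal (integral_nonneg fun x => gaussianPDFReal_nonneg _ _ _)]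
  have hle : ∫ _ in Set.Ioo τ (2 * τ), (√(2 * π))⁻¹ * exp (-2 * τ ^ 2)
      ≤ ∫ x in Set.Ioo τ (2 * τ), gaussianPDFReal 0 1 x := by
    refine setIntegral_mono_on (integrableOn_const (by simp)) (integrable_gaussianPDFReal 0 1).integrableOn
      measurableSet_Ioo fun x hx => ?_
    rw [gaussianPDFReal_zero_one]
    gcongr
    nlinarith [hx.1, hx.2]
  refine le_trans ?_ hle
  rw [setIntegral_const, Real.volume_real_Ioo_of_le (by linarith), smul_eq_mul, mul_inv, mul_assoc]
  gcongr
  linarith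

/-- The conditional absolute moment of a standard Gaussian above a threshold `τ` bounded away from
zero is at most of order `τ ^ γ`. -/
lemma exists_setIntegral_abs_rpow_le {γ : ℝ} (hγ : 0 < γ) :
    ∃ K : ℝ, 0 < K ∧ ∀ τ : ℝ, 1 / 2 ≤ τ →
      ∫ x in {x : ℝ | τ ^ 2 < x ^ 2}, |x| ^ γ ∂(gaussianReal 0 1) ≤
        K * τ ^ γ * (gaussianReal 0 1).real {x : ℝ | τ ^ 2 < x ^ 2} := by
  set M := ∫ x, exp (3 / 8 * x ^ 2) ∂(gaussianReal 0 1) with hM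
  have hM0 : 0 ≤ M := integral_nonneg fun x => (exp_pos _).le
  have hint := integrable_exp_mul_sq_gaussianReal (c := 3 / 8) (by norm_num)
  refine ⟨3 ^ γ + 2 ^ γ * (exp (8 * γ ^ 2) * M * (2 * √(2 * π))), by positivity, fun τ hτ => ?_⟩
  have hτ0 : 0 < τ := by linarith
  have hpt : ∀ x : ℝ, |x| ^ γ ≤
      (3 * τ) ^ γ + exp (8 * γ ^ 2) * exp (-2 * τ ^ 2) * exp (3 / 8 * x ^ 2) := by
    intro x
    rcases le_or_gt |x| (3 * τ) with h | h
    · have := rpow_le_rpow (abs_nonneg x) h hγ.le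
      have : 0 ≤ exp (8 * γ ^ 2) * exp (-2 * τ ^ 2) * exp (3 / 8 * x ^ 2) := by positivity
      linarith
    · have h1 := (abs_rpow_le_one_add_two_mul_abs_rpow hγ.le x).trans
        (one_add_two_mul_abs_rpow_le hγ.le x)
      have h2 : exp (x ^ 2 / 8) ≤ exp (-2 * τ ^ 2) * exp (3 / 8 * x ^ 2) := by
        rw [← exp_add]
        apply exp_le_exp.2
        rw [← sq_abs x]
        nlinarith
      have h3 : 0 ≤ (3 * τ) ^ γ := by positivity
      have h4 := mul_le_mul_of_nonneg_left h2 (exp_pos (8 * γ ^ 2)).le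
      linarith
  have hP := exp_neg_two_mul_sq_le_gaussianReal_lt_sq hτ
  set A : Set ℝ := {x : ℝ | τ ^ 2 < x ^ 2}
  set P := (gaussianReal 0 1).real A
  have hint' := hint.const_mul (exp (8 * γ ^ 2) * exp (-2 * τ ^ 2))
  have hle : ∫ x in A, |x| ^ γ ∂(gaussianReal 0 1) ≤
      (3 * τ) ^ γ * P + exp (8 * γ ^ 2) * exp (-2 * τ ^ 2) * M := by
    calc ∫ x in A, |x| ^ γ ∂(gaussianReal 0 1)
        ≤ ∫ x in A, ((3 * τ) ^ γ + exp (8 * γ ^ 2) * exp (-2 * τ ^ 2) * exp (3 / 8 * x ^ 2))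
            ∂(gaussianReal 0 1) :=
          integral_mono (integrable_abs_rpow_gaussianReal hγ.le).integrableOn
            ((integrable_const _).add hint').integrableOn hpt
      _ = (3 * τ) ^ γ * P + ∫ x in A, exp (8 * γ ^ 2) * exp (-2 * τ ^ 2) * exp (3 / 8 * x ^ 2)
            ∂(gaussianReal 0 1) := by
          rw [integral_add (integrable_const _).integrableOn hint'.integrableOn, setIntegral_const,
            smul_eq_mul, mul_comm]
      _ ≤ _ := by
          gcongr
          rw [hM, ← integral_const_mul]
          exact setIntegral_le_integral hint' (ae_of_all _ fun x => by positivity)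
  have hτγ : 1 ≤ 2 ^ γ * τ ^ γ := by
    rw [← mul_rpow (by norm_num) hτ0.le]
    exact one_le_rpow (by linarith) hγ.le
  have hexp : exp (-2 * τ ^ 2) ≤ 2 * √(2 * π) * P := by
    rw [inv_mul_le_iff₀ (by positivity)] at hP
    exact hP
  have hP0 : 0 ≤ P := measureReal_nonneg
  calc _ ≤ _ := hle
    _ ≤ (3 * τ) ^ γ * P + exp (8 * γ ^ 2) * (2 * √(2 * π) * P) * M := by gcongr
    _ = (3 * τ) ^ γ * P + 1 * (exp (8 * γ ^ 2) * (2 * √(2 * π) * P) * M) := by ring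
    _ ≤ (3 * τ) ^ γ * P + 2 ^ γ * τ ^ γ * (exp (8 * γ ^ 2) * (2 * √(2 * π) * P) * M) := by gcongr
    _ = _ := by
        rw [mul_rpow (by norm_num) hτ0.le]
        ring

/-- Gaussian tail bound for absolute moments, with the sharp exponential rate. -/
lemma exists_setIntegral_abs_rpow_le_exp {p : ℝ} (hp : 0 ≤ p) :
    ∃ K : ℝ, 0 < K ∧ ∀ τ : ℝ, 1 / 2 ≤ τ →
      ∫ x in {x : ℝ | τ ^ 2 < x ^ 2}, |x| ^ p ∂(gaussianReal 0 1) ≤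
        K * τ ^ p * exp (-τ ^ 2 / 2) := by
  set H : ℝ → ℝ := fun u => gaussianPDFReal 0 1 u * (1 + 2 * |u|) ^ p
  have hH : Integrable H :=
    integrable_gaussianReal_zero_one_iff.1 (integrable_one_add_two_mul_abs_rpow hp)
  have hH0 : ∀ u, 0 ≤ H u := fun u => mul_nonneg (gaussianPDFReal_nonneg _ _ _) (by positivity)
  have hI0 : 0 ≤ ∫ u, H u := integral_nonneg hH0
  refine ⟨2 * (∫ u, H u) + 1, by positivity, fun τ hτ => ?_⟩
  have hτ0 : 0 < τ := by linarith
  have hshift : ∀ v : ℝ, 0 ≤ v → gaussianPDFReal 0 1 (v + τ) * (v + τ) ^ p ≤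
      τ ^ p * exp (-τ ^ 2 / 2) * H v := by
    intro v hv
    have h1 : (v + τ) ^ p ≤ τ ^ p * (1 + 2 * |v|) ^ p := by
      rw [← mul_rpow hτ0.le (by positivity), abs_of_nonneg hv]
      apply rpow_le_rpow (by positivity) _ hp
      nlinarith
    have h2 : gaussianPDFReal 0 1 (v + τ) ≤ exp (-τ ^ 2 / 2) * gaussianPDFReal 0 1 v := by
      rw [gaussianPDFReal_zero_one, gaussianPDFReal_zero_one, mul_left_comm, ← exp_add]
      gcongr
      nlinarith
    calc _ ≤ (exp (-τ ^ 2 / 2) * gaussianPDFReal 0 1 v) * (τ ^ p * (1 + 2 * |v|) ^ p) :=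
          mul_le_mul h2 h1 (by positivity) (mul_nonneg (exp_pos _).le (gaussianPDFReal_nonneg _ _ _))
      _ = _ := by simp only [H]; ring
  have heven : ∀ u, H (-u) = H u := fun u => by simp [H, gaussianPDFReal_zero_one]
  rw [← integral_indicator (measurableSet_lt_sq _), integral_gaussianReal_eq_integral_smul one_ne_zero]
  have hdom : Integrable fun x => τ ^ p * exp (-τ ^ 2 / 2) * (H (x - τ) + H (x + τ)) :=
    ((hH.comp_sub_right τ).add (hH.comp_add_right τ)).const_mul _
  calc _ ≤ ∫ x, τ ^ p * exp (-τ ^ 2 / 2) * (H (x - τ) + H (x + τ)) := by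
        refine integral_mono_of_nonneg (ae_of_all _ fun x => ?_) hdom (ae_of_all _ fun x => ?_)
        · exact mul_nonneg (gaussianPDFReal_nonneg _ _ _)
            (Set.indicator_nonneg (fun _ _ => by positivity) _)
        · have hc : 0 ≤ τ ^ p * exp (-τ ^ 2 / 2) := by positivity
          have hm := mul_nonneg hc (hH0 (x - τ))
          have hq := mul_nonneg hc (hH0 (x + τ))
          by_cases hx : τ ^ 2 < x ^ 2
          · have hx' := sq_lt_sq.1 hx
            rw [abs_of_pos hτ0] at hx'
            simp only [Set.indicator, Set.mem_ofPred_eq, hx, if_true, smul_eq_mul, mul_add]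
            have h := hshift (|x| - τ) (by linarith)
            rw [sub_add_cancel] at h
            rcases abs_cases x with ⟨h1, h2⟩ | ⟨h1, h2⟩
            · rw [h1] at h ⊢
              linarith
            · rw [← heven (|x| - τ)] at h
              simp only [gaussianPDFReal_zero_one, sq_abs] at h ⊢
              rw [show -(|x| - τ) = x + τ by rw [h1]; ring] at h
              linarith
          · simp only [Set.indicator, Set.mem_ofPred_eq, hx, if_false, smul_zero, mul_add]
            linarith
    _ = τ ^ p * exp (-τ ^ 2 / 2) * (2 * ∫ u, H u) := by
        rw [integral_const_mul, integral_add (hH.comp_sub_right τ) (hH.comp_add_right τ),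
          integral_sub_right_eq_self H τ, integral_add_right_eq_self H τ]
        ring
    _ ≤ _ := by
        have : 0 ≤ τ ^ p * exp (-τ ^ 2 / 2) := by positivity
        linarith

section Pi

variable {ι : Type*} [Fintype ι] {μ : ι → Measure ℝ} [∀ i, IsProbabilityMeasure (μ i)]
  {g : ι → ℝ → ℝ}

lemma integral_pi_sum_sq_le (S : Finset ι) {a : ι → ℝ} {K : ℝ} (ha : ∀ i, 0 < a i)
    (hg : ∀ i, MemLp (g i) 2 (μ i)) (hK : ∀ i, ∫ x, g i x ^ 2 ∂(μ i) ≤ K * a i ^ 2) :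
    ∫ y, (∑ i ∈ S, g i (y i)) ^ 2 ∂(Measure.pi μ) ≤ K * (∑ i ∈ S, a i) ^ 2 := by
  have hint : ∀ i, Integrable (fun y : ι → ℝ => g i (y i) ^ 2 / a i) (Measure.pi μ) := fun i =>
    (integrable_comp_eval (μ := μ) (i := i) (f := fun x => g i x ^ 2)
      (hg i).integrable_sq).div_const _
  have hpt : ∀ y : ι → ℝ, (∑ i ∈ S, g i (y i)) ^ 2 ≤
      (∑ i ∈ S, a i) * ∑ i ∈ S, g i (y i) ^ 2 / a i := by
    intro y
    rcases S.eq_empty_or_nonempty with rfl | hS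
    · simp
    have h := Finset.sq_sum_div_le_sum_sq_div S (fun i => g i (y i)) (g := a) fun i _ => ha i
    rwa [div_le_iff₀' (Finset.sum_pos (fun i _ => ha i) hS)] at h
  have hsum : 0 ≤ ∑ i ∈ S, a i := Finset.sum_nonneg fun i _ => (ha i).le
  calc _ ≤ ∫ y, (∑ i ∈ S, a i) * ∑ i ∈ S, g i (y i) ^ 2 / a i ∂(Measure.pi μ) :=
        integral_mono_of_nonneg (ae_of_all _ fun y => sq_nonneg _)
          ((integrable_finsetSum _ fun i _ => hint i).const_mul _) (ae_of_all _ hpt)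
    _ = (∑ i ∈ S, a i) * ∑ i ∈ S, (∫ x, g i x ^ 2 ∂(μ i)) / a i := by
        rw [integral_const_mul, integral_finsetSum _ fun i _ => hint i]
        congr 1
        refine Finset.sum_congr rfl fun i _ => ?_
        rw [integral_div, integral_comp_eval (μ := μ) (i := i) (f := fun x => g i x ^ 2)
          (hg i).integrable_sq.aestronglyMeasurable]
    _ ≤ (∑ i ∈ S, a i) * ∑ i ∈ S, K * a i := by
        gcongr with i _
        rw [div_le_iff₀ (ha i)]
        linarith [hK i]
    _ = _ := by rw [← Finset.mul_sum]; ring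

lemma integral_pi_sum_sq_of_integral_eq_zero (T : Finset ι) (hg : ∀ i, MemLp (g i) 2 (μ i))
    (h0 : ∀ i ∈ T, ∫ x, g i x ∂(μ i) = 0) :
    ∫ y, (∑ i ∈ T, g i (y i)) ^ 2 ∂(Measure.pi μ) = ∑ i ∈ T, ∫ x, g i x ^ 2 ∂(μ i) := by
  have hL : ∀ i, MemLp (fun y : ι → ℝ => g i (y i)) 2 (Measure.pi μ) := fun i =>
    (hg i).comp_measurePreserving (measurePreserving_eval μ i)
  have hmean : ∀ i ∈ T, ∫ y : ι → ℝ, g i (y i) ∂(Measure.pi μ) = 0 := fun i hi => by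
    rw [integral_comp_eval (hg i).aestronglyMeasurable, h0 i hi]
  have hvar := IndepFun.variance_sum (s := T) (fun i _ => hL i) fun i _ j _ hij =>
    (iIndepFun_pi fun i => (hg i).aestronglyMeasurable.aemeasurable).indepFun hij
  rw [variance_of_integral_eq_zero] at hvar
  · simp only [Finset.sum_apply] at hvar
    rw [hvar]
    refine Finset.sum_congr rfl fun i hi => ?_
    rw [variance_of_integral_eq_zero (hL i).aestronglyMeasurable.aemeasurable (hmean i hi)]
    exact integral_comp_eval (μ := μ) (i := i) (f := fun x => g i x ^ 2)
      (hg i).integrable_sq.aestronglyMeasurable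
  · exact (memLp_finsetSum' T fun i _ => hL i).aestronglyMeasurable.aemeasurable
  · simp only [Finset.sum_apply]
    rw [integral_finsetSum _ fun i _ => (hL i).integrable one_le_two]
    exact Finset.sum_eq_zero hmean

end Pi

/-- The error made by one thresholded coordinate `y` in estimating `|t| ^ γ`. -/
noncomputable def thresholdError (γ ε α τ t y : ℝ) : ℝ :=
  (|y| ^ γ - ε ^ γ * α) * (if ε ^ 2 * τ ^ 2 < y ^ 2 then 1 else 0) - |t| ^ γ

lemma measurable_thresholdError (γ ε α τ t : ℝ) : Measurable (thresholdError γ ε α τ t) := by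
  unfold thresholdError
  refine Measurable.sub (Measurable.mul (by fun_prop) ?_) measurable_const
  exact Measurable.ite (measurableSet_lt_sq _) measurable_const measurable_const

lemma measurePreserving_gaussianReal (t ε : ℝ) :
    MeasurePreserving (fun x => t + ε * x) (gaussianReal 0 1)
      (gaussianReal t (ε ^ 2).toNNReal) := by
  refine ⟨by fun_prop, ?_⟩
  have h : (fun x : ℝ => t + ε * x) = (fun x => t + x) ∘ (fun x => ε * x) := rfl
  rw [h, ← Measure.map_map (by fun_prop) (by fun_prop), gaussianReal_map_const_mul,
    gaussianReal_map_const_add]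
  congr 1
  · simp
  · ext
    simp [Real.coe_toNNReal _ (sq_nonneg ε)]

lemma integral_gaussianReal_eq_integral_comp {f : ℝ → ℝ} (hf : Measurable f) (t ε : ℝ) :
    ∫ y, f y ∂(gaussianReal t (ε ^ 2).toNNReal) = ∫ x, f (t + ε * x) ∂(gaussianReal 0 1) := by
  rw [← (measurePreserving_gaussianReal t ε).map_eq,
    integral_map (by fun_prop) hf.aestronglyMeasurable]

/-- The order of magnitude of `thresholdError`. -/
noncomputable def thresholdScale (γ ε τ t : ℝ) : ℝ :=
  ε ^ γ * τ ^ γ + ε * |t| ^ (γ - 1) * (if 1 < γ then 1 else 0)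

lemma thresholdScale_pos {γ ε τ : ℝ} (hε : 0 < ε) (hτ : 0 < τ) (t : ℝ) :
    0 < thresholdScale γ ε τ t := by
  unfold thresholdScale
  have h : (0 : ℝ) ≤ if 1 < γ then 1 else 0 := by split_ifs <;> norm_num
  positivity

lemma abs_thresholdError_le {γ ε α τ K : ℝ} (hγ : 0 < γ) (hε : 0 < ε) (hτ : 1 / 2 ≤ τ)
    (hα0 : 0 ≤ α) (hα : α ≤ K * τ ^ γ) (hK : 0 ≤ K) (t x : ℝ) :
    |thresholdError γ ε α τ t (t + ε * x)| ≤
      (γ * 2 ^ γ + 1 + K) * thresholdScale γ ε τ t * (1 + 2 * |x|) ^ (γ + 1) := by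
  have hτ0 : 0 < τ := by linarith
  set a := thresholdScale γ ε τ t with ha
  set y := t + ε * x with hy
  set G := 1 + 2 * |x| with hG
  set I : ℝ := if 1 < γ then 1 else 0 with hI
  have hI0 : 0 ≤ I := by rw [hI]; split_ifs <;> norm_num
  have hx0 := abs_nonneg x
  have hG1 : 1 ≤ G := by linarith
  have hGp : G ^ γ ≤ G ^ (γ + 1) := rpow_le_rpow_of_exponent_le hG1 (by linarith)
  have hG1p : 1 ≤ G ^ (γ + 1) := one_le_rpow hG1 (by linarith)
  have hxG : |x| ≤ G ^ (γ + 1) := by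
    have : G ^ (1 : ℝ) ≤ G ^ (γ + 1) := rpow_le_rpow_of_exponent_le hG1 (by linarith)
    rw [rpow_one] at this
    linarith
  have hscale : (ε * (τ * G)) ^ γ ≤ ε ^ γ * τ ^ γ * G ^ (γ + 1) := by
    rw [mul_rpow hε.le (by positivity), mul_rpow hτ0.le (by positivity), ← mul_assoc]
    gcongr
  have hεx : |ε * x| = ε * |x| := by rw [abs_mul, abs_of_pos hε]
  have hdist : |(|y| - |t|)| ≤ ε * |x| := by
    refine (abs_abs_sub_abs_le y t).trans ?_
    rw [hy, add_sub_cancel_left, hεx]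
  have hea : ε ^ γ * τ ^ γ ≤ a := by
    rw [ha, thresholdScale]
    have : 0 ≤ ε * |t| ^ (γ - 1) * I := by positivity
    linarith
  have ha0 : 0 < a := thresholdScale_pos hε hτ0 t
  unfold thresholdError
  split_ifs with hyt
  · have h1 := abs_rpow_sub_rpow_le hγ (abs_nonneg y) (abs_nonneg t) hdist
    have h2 : (ε * |x|) ^ γ + ε * |x| * |t| ^ (γ - 1) * I ≤ a * G ^ (γ + 1) := by
      have h3 : (ε * |x|) ^ γ ≤ ε ^ γ * τ ^ γ * G ^ (γ + 1) := by
        refine le_trans (rpow_le_rpow (by positivity) ?_ hγ.le) hscale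
        gcongr
        nlinarith
      have h4 : ε * |x| * |t| ^ (γ - 1) * I ≤ ε * G ^ (γ + 1) * |t| ^ (γ - 1) * I := by gcongr
      rw [ha, thresholdScale, add_mul]
      linarith
    have h5 : ε ^ γ * α ≤ K * a * G ^ (γ + 1) := by
      calc ε ^ γ * α ≤ ε ^ γ * (K * τ ^ γ) := by gcongr
        _ = K * (ε ^ γ * τ ^ γ) * 1 := by ring
        _ ≤ _ := by gcongr
    have h6 : 0 ≤ ε ^ γ * α := by positivity
    calc |(|y| ^ γ - ε ^ γ * α) * 1 - |t| ^ γ| = |(|y| ^ γ - |t| ^ γ) - ε ^ γ * α| := by ring_nf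
      _ ≤ |(|y| ^ γ - |t| ^ γ)| + |ε ^ γ * α| := abs_sub _ _
      _ ≤ (γ * 2 ^ γ + 1) * (a * G ^ (γ + 1)) + K * a * G ^ (γ + 1) := by
          rw [abs_of_nonneg h6]
          refine add_le_add (h1.trans ?_) h5
          gcongr
      _ = _ := by ring
  · rw [mul_zero, zero_sub, abs_neg, abs_of_nonneg (by positivity)]
    have hy' : |y| ≤ ε * τ := by
      rw [← mul_pow] at hyt
      exact abs_le_of_sq_le_sq (not_lt.1 hyt) (by positivity)
    have ht : |t| ≤ ε * (τ * G) := by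
      have := (abs_le.1 hdist).1
      nlinarith [mul_nonneg hε.le hx0, mul_nonneg (mul_nonneg hε.le hx0) (sub_nonneg.2 hτ)]
    have h1 : |t| ^ γ ≤ a * G ^ (γ + 1) :=
      ((rpow_le_rpow (abs_nonneg t) ht hγ.le).trans hscale).trans (by gcongr)
    have h2 : 0 ≤ (γ * 2 ^ γ + K) * (a * G ^ (γ + 1)) := by positivity
    linarith

lemma exists_integral_thresholdError_sq_le {γ K : ℝ} (hγ : 0 < γ) (hK : 0 ≤ K) :
    ∃ K' : ℝ, 0 < K' ∧ ∀ ε α τ : ℝ, 0 < ε → 1 / 2 ≤ τ → 0 ≤ α → α ≤ K * τ ^ γ → ∀ t : ℝ,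
      MemLp (thresholdError γ ε α τ t) 2 (gaussianReal t (ε ^ 2).toNNReal) ∧
      ∫ y, thresholdError γ ε α τ t y ^ 2 ∂(gaussianReal t (ε ^ 2).toNNReal) ≤
        K' * thresholdScale γ ε τ t ^ 2 := by
  have hp : 0 ≤ 2 * (γ + 1) := by linarith
  have hint := integrable_one_add_two_mul_abs_rpow hp
  have hJ : 0 ≤ ∫ x, (1 + 2 * |x|) ^ (2 * (γ + 1)) ∂(gaussianReal 0 1) :=
    integral_nonneg fun x => by positivity
  refine ⟨(γ * 2 ^ γ + 1 + K) ^ 2 * (∫ x, (1 + 2 * |x|) ^ (2 * (γ + 1)) ∂(gaussianReal 0 1)) + 1,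
    by positivity, fun ε α τ hε hτ hα0 hα t => ?_⟩
  set c := (γ * 2 ^ γ + 1 + K) * thresholdScale γ ε τ t with hc
  have hsq : ∀ x : ℝ, thresholdError γ ε α τ t (t + ε * x) ^ 2 ≤
      c ^ 2 * (1 + 2 * |x|) ^ (2 * (γ + 1)) := by
    intro x
    have h := abs_thresholdError_le hγ hε hτ hα0 hα hK t x
    rw [mul_comm 2 (γ + 1), rpow_mul (by positivity), rpow_two, ← mul_pow, ← sq_abs]
    exact pow_le_pow_left₀ (abs_nonneg _) h 2
  have hmeas := measurable_thresholdError γ ε α τ t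
  have hmeas' : Measurable fun x => thresholdError γ ε α τ t (t + ε * x) :=
    hmeas.comp (by fun_prop)
  have hmp := measurePreserving_gaussianReal t ε
  constructor
  · rw [← hmp.map_eq, memLp_map_measure_iff hmeas.aestronglyMeasurable (by fun_prop),
      memLp_two_iff_integrable_sq]
    · refine (hint.const_mul (c ^ 2)).mono' (hmeas'.pow_const 2).aestronglyMeasurable
        (ae_of_all _ fun x => ?_)
      rw [norm_of_nonneg (sq_nonneg _)]
      exact hsq x
    · exact hmeas'.aestronglyMeasurable
  · rw [integral_gaussianReal_eq_integral_comp (hmeas.pow_const 2)]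
    calc _ ≤ ∫ x, c ^ 2 * (1 + 2 * |x|) ^ (2 * (γ + 1)) ∂(gaussianReal 0 1) :=
          integral_mono_of_nonneg (ae_of_all _ fun x => sq_nonneg _) (hint.const_mul _)
            (ae_of_all _ hsq)
      _ ≤ _ := by
          rw [integral_const_mul, hc]
          nlinarith [sq_nonneg (thresholdScale γ ε τ t)]

lemma thresholdError_zero {γ ε : ℝ} (hγ : 0 < γ) (hε : 0 < ε) (α τ x : ℝ) :
    thresholdError γ ε α τ 0 (0 + ε * x) =
      ε ^ γ * {x : ℝ | τ ^ 2 < x ^ 2}.indicator (fun x => |x| ^ γ - α) x := by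
  have h : ε ^ 2 * τ ^ 2 < (ε * x) ^ 2 ↔ τ ^ 2 < x ^ 2 := by
    rw [mul_pow]
    exact mul_lt_mul_iff_right₀ (by positivity)
  simp only [thresholdError, zero_add, h, Set.indicator, Set.mem_ofPred_eq, abs_zero,
    zero_rpow hγ.ne', sub_zero, abs_mul, abs_of_pos hε, mul_rpow hε.le (abs_nonneg x)]
  split_ifs <;> ring

section Null

variable {γ ε α τ : ℝ}

lemma setIntegral_abs_rpow_sub_eq_zero (hγ : 0 < γ)
    (hα : ∫ x in {x : ℝ | τ ^ 2 < x ^ 2}, |x| ^ γ ∂(gaussianReal 0 1) =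
      α * (gaussianReal 0 1).real {x : ℝ | τ ^ 2 < x ^ 2}) :
    ∫ x in {x : ℝ | τ ^ 2 < x ^ 2}, (|x| ^ γ - α) ∂(gaussianReal 0 1) = 0 := by
  rw [integral_sub (integrable_abs_rpow_gaussianReal hγ.le).integrableOn
    (integrable_const _).integrableOn, hα, setIntegral_const, smul_eq_mul]
  ring

lemma integral_thresholdError_zero (hγ : 0 < γ) (hε : 0 < ε)
    (hα : ∫ x in {x : ℝ | τ ^ 2 < x ^ 2}, |x| ^ γ ∂(gaussianReal 0 1) =
      α * (gaussianReal 0 1).real {x : ℝ | τ ^ 2 < x ^ 2}) :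
    ∫ y, thresholdError γ ε α τ 0 y ∂(gaussianReal 0 (ε ^ 2).toNNReal) = 0 := by
  rw [integral_gaussianReal_eq_integral_comp (measurable_thresholdError _ _ _ _ _)]
  simp only [thresholdError_zero hγ hε]
  rw [integral_const_mul, integral_indicator (measurableSet_lt_sq _),
    setIntegral_abs_rpow_sub_eq_zero hγ hα, mul_zero]

lemma integral_thresholdError_zero_sq_le (hγ : 0 < γ) (hε : 0 < ε)
    (hα : ∫ x in {x : ℝ | τ ^ 2 < x ^ 2}, |x| ^ γ ∂(gaussianReal 0 1) =
      α * (gaussianReal 0 1).real {x : ℝ | τ ^ 2 < x ^ 2}) :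
    ∫ y, thresholdError γ ε α τ 0 y ^ 2 ∂(gaussianReal 0 (ε ^ 2).toNNReal) ≤
      ε ^ (2 * γ) * ∫ x in {x : ℝ | τ ^ 2 < x ^ 2}, |x| ^ (2 * γ) ∂(gaussianReal 0 1) := by
  rw [integral_gaussianReal_eq_integral_comp ((measurable_thresholdError _ _ _ _ _).pow_const 2)]
  set A : Set ℝ := {x : ℝ | τ ^ 2 < x ^ 2}
  have hsq : ∀ z : ℝ, 0 ≤ z → z ^ (2 * γ) = (z ^ γ) ^ 2 := fun z hz => by
    rw [mul_comm, rpow_mul hz, rpow_two]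
  have hpt : ∀ x : ℝ, thresholdError γ ε α τ 0 (0 + ε * x) ^ 2 =
      ε ^ (2 * γ) * A.indicator (fun x => (|x| ^ γ - α) ^ 2) x := by
    intro x
    rw [thresholdError_zero hγ hε, mul_pow, hsq ε hε.le]
    by_cases hx : x ∈ A <;> simp [A, hx]
  simp only [hpt]
  rw [integral_const_mul, integral_indicator (measurableSet_lt_sq _)]
  refine mul_le_mul_of_nonneg_left ?_ (by positivity)
  have hi1 := integrable_abs_rpow_gaussianReal (p := 2 * γ) (by linarith)
  have hi2 : Integrable (fun x => |x| ^ γ - α) (gaussianReal 0 1) :=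
    (integrable_abs_rpow_gaussianReal hγ.le).sub (integrable_const α)
  calc ∫ x in A, (|x| ^ γ - α) ^ 2 ∂(gaussianReal 0 1)
      ≤ ∫ x in A, (|x| ^ (2 * γ) - 2 * α * (|x| ^ γ - α)) ∂(gaussianReal 0 1) := by
        refine integral_mono_of_nonneg (ae_of_all _ fun x => sq_nonneg _)
          (hi1.sub (hi2.const_mul (2 * α))).integrableOn (ae_of_all _ fun x => ?_)
        simp only [hsq _ (abs_nonneg x)]
        nlinarith [sq_nonneg α]
    _ = _ := by
        rw [integral_sub hi1.integrableOn (hi2.const_mul (2 * α)).integrableOn,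
          integral_const_mul, setIntegral_abs_rpow_sub_eq_zero hγ hα]
        ring

end Null

lemma sum_abs_rpow_sub_one_sq_le {ι : Type*} [Fintype ι] {γ s : ℝ} (hγ : 1 < γ) (θ : ι → ℝ)
    (S : Finset ι) (hS : (S.card : ℝ) ≤ s) :
    (∑ i ∈ S, |θ i| ^ (γ - 1)) ^ 2 ≤
      s ^ (2 / γ) * ((∑ i, |θ i| ^ γ) ^ (1 / γ)) ^ (2 * γ - 2) := by
  have hγ0 : 0 < γ := by linarith
  have hγ1 : 0 < γ - 1 := by linarith
  have hs : 0 ≤ s := (Nat.cast_nonneg _).trans hS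
  have hN : ∀ T : Finset ι, 0 ≤ ∑ i ∈ T, |θ i| ^ γ := fun T =>
    Finset.sum_nonneg fun i _ => by positivity
  have hpq : HolderConjugate (γ / (γ - 1)) γ := (HolderConjugate.conjExponent hγ).symm
  have h := inner_le_Lp_mul_Lq S (fun i => |θ i| ^ (γ - 1)) (fun _ => 1) hpq
  have hterm : ∀ i, |(|θ i| ^ (γ - 1))| ^ (γ / (γ - 1)) = |θ i| ^ γ := fun i => by
    rw [abs_of_nonneg (by positivity), ← rpow_mul (abs_nonneg _), mul_div_cancel₀ _ hγ1.ne']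
  simp only [hterm, mul_one, abs_one, one_rpow, Finset.sum_const, nsmul_eq_mul] at h
  have hle : ∑ i ∈ S, |θ i| ^ (γ - 1) ≤
      (∑ i, |θ i| ^ γ) ^ (1 / (γ / (γ - 1))) * s ^ (1 / γ) := by
    refine h.trans (mul_le_mul ?_ ?_ (by positivity) (rpow_nonneg (hN _) _))
    · exact rpow_le_rpow (hN S) (Finset.sum_le_sum_of_subset_of_nonneg (Finset.subset_univ S)
        fun i _ _ => by positivity) (by positivity)
    · exact rpow_le_rpow (by positivity) hS (by positivity)
  refine (pow_le_pow_left₀ (Finset.sum_nonneg fun i _ => by positivity) hle 2).trans_eq ?_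
  rw [mul_pow, ← rpow_two, ← rpow_two, ← rpow_mul (hN _), ← rpow_mul hs, ← rpow_mul (hN _),
    mul_comm]
  congr 2 <;> field_simp

/-- Theorem 4 (sparse zone upper bound for estimating `N_γ(θ) = ∑ |θ_i|^γ`).
For every `γ > 0` there is a constant `C > 0` depending only on `γ` such that for all
integers `1 ≤ s ≤ d` with `s² ≤ 4d` and every `ε > 0`, the thresholding estimator
`N̂*_γ = ∑_i (|y_i|^γ − ε^γ α_γ) 1_{y_i² > 2ε² log(1+d/s²)}`, where
`α_γ = E(|ξ|^γ 1_{ξ² > 2 log(1+d/s²)}) / P(ξ² > 2 log(1+d/s²))` for `ξ ~ N(0,1)`,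
computed from observations `y ~ ⊗_i N(θ_i, ε²)`, satisfies the stated risk bound for
every `s`-sparse `θ`. -/
theorem sparse_zone_upper_bound_Ngamma (γ : ℝ) (hγ : 0 < γ) :
    ∃ C : ℝ, 0 < C ∧
      ∀ d s : ℕ, 1 ≤ s → s ≤ d → s ^ 2 ≤ 4 * d →
        ∀ ε : ℝ, 0 < ε →
          let α : ℝ :=
            (∫ x in {x : ℝ | 2 * Real.log (1 + (d : ℝ) / (s : ℝ) ^ 2) < x ^ 2}, |x| ^ γ
                ∂(gaussianReal 0 1)) /
              ((gaussianReal 0 1)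
                {x : ℝ | 2 * Real.log (1 + (d : ℝ) / (s : ℝ) ^ 2) < x ^ 2}).toReal
          ∀ θ : Fin d → ℝ, (Finset.univ.filter fun i => θ i ≠ 0).card ≤ s →
            ∫ y, ((∑ i, (|y i| ^ γ - ε ^ γ * α) *
                    (if 2 * ε ^ 2 * Real.log (1 + (d : ℝ) / (s : ℝ) ^ 2) < (y i) ^ 2
                      then (1 : ℝ) else 0))
                  - ∑ i, |θ i| ^ γ) ^ 2
                ∂(Measure.pi fun i : Fin d => gaussianReal (θ i) (ε ^ 2).toNNReal)
              ≤ C * (ε ^ (2 * γ) * (s : ℝ) ^ 2 * Real.log (1 + (d : ℝ) / (s : ℝ) ^ 2) ^ γ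
                  + ε ^ 2 * (s : ℝ) ^ (2 / γ)
                    * ((∑ i, |θ i| ^ γ) ^ (1 / γ)) ^ (2 * γ - 2)
                    * (if 1 < γ then (1 : ℝ) else 0)) := by
  obtain ⟨K₁, hK₁, hα_le⟩ := exists_setIntegral_abs_rpow_le hγ
  obtain ⟨K₂, hK₂, hmom⟩ := exists_setIntegral_abs_rpow_le_exp (p := 2 * γ) (by linarith)
  obtain ⟨K₃, hK₃, hcoord⟩ := exists_integral_thresholdError_sq_le hγ hK₁.le
  refine ⟨4 * K₃ * 2 ^ γ + 4 * K₃ + 2 * K₂ * 2 ^ γ, by positivity, ?_⟩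
  intro d s hs hsd hs4 ε hε α θ hθ
  have hs0 : (0 : ℝ) < s := by exact_mod_cast hs
  have hd0 : (0 : ℝ) < d := by exact_mod_cast hs.trans hsd
  have hs4' : (s : ℝ) ^ 2 ≤ 4 * d := by exact_mod_cast hs4
  set L := Real.log (1 + (d : ℝ) / (s : ℝ) ^ 2) with hL
  have hq : (1 : ℝ) / 4 ≤ (d : ℝ) / (s : ℝ) ^ 2 := by
    rw [div_le_div_iff₀ (by norm_num) (by positivity)]
    linarith
  have hL1 : 1 / 5 ≤ L := by
    have h := one_sub_inv_le_log_of_pos (x := 1 + (d : ℝ) / (s : ℝ) ^ 2) (by positivity)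
    have h2 : (1 + (d : ℝ) / (s : ℝ) ^ 2)⁻¹ ≤ (5 / 4)⁻¹ := inv_anti₀ (by norm_num) (by linarith)
    linarith
  have hexpL : d * exp (-L) ≤ (s : ℝ) ^ 2 := by
    rw [exp_neg, hL, exp_log (by positivity), ← div_eq_mul_inv, div_le_iff₀ (by positivity)]
    field_simp
    nlinarith [sq_nonneg (s : ℝ)]
  obtain ⟨τ, hτ, hτL⟩ : ∃ τ : ℝ, 1 / 2 ≤ τ ∧ 2 * L = τ ^ 2 :=
    ⟨√(2 * L), le_sqrt_of_sq_le (by linarith), (sq_sqrt (by linarith)).symm⟩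
  have hτ0 : 0 < τ := by linarith
  have hτγ : τ ^ (2 * γ) = 2 ^ γ * L ^ γ := by
    rw [rpow_mul hτ0.le, rpow_two, ← hτL, mul_rpow (by norm_num) (by linarith)]
  set P := (gaussianReal 0 1).real {x : ℝ | τ ^ 2 < x ^ 2} with hP
  have hP0 : 0 < P :=
    lt_of_lt_of_le (by positivity) (exp_neg_two_mul_sq_le_gaussianReal_lt_sq hτ)
  have hα : α = (∫ x in {x : ℝ | τ ^ 2 < x ^ 2}, |x| ^ γ ∂(gaussianReal 0 1)) / P := by
    simp only [α, ← hL, hτL, hP, measureReal_def]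
  have hα0 : 0 ≤ α := by
    rw [hα]
    exact div_nonneg (integral_nonneg fun x => by positivity) hP0.le
  have hαK : α ≤ K₁ * τ ^ γ := by
    rw [hα, div_le_iff₀ hP0]
    exact hα_le τ hτ
  have hαP : ∫ x in {x : ℝ | τ ^ 2 < x ^ 2}, |x| ^ γ ∂(gaussianReal 0 1) = α * P := by
    rw [hα, div_mul_cancel₀ _ hP0.ne']
  clear_value α
  set S : Finset (Fin d) := Finset.univ.filter fun i => θ i ≠ 0 with hS
  set g : Fin d → ℝ → ℝ := fun i => thresholdError γ ε α τ (θ i)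
  have hg : ∀ i, MemLp (g i) 2 (gaussianReal (θ i) (ε ^ 2).toNNReal) := fun i =>
    (hcoord ε α τ hε hτ hα0 hαK (θ i)).1
  have hzero : ∀ i ∈ Sᶜ, θ i = 0 := fun i hi => by simpa [hS] using hi
  set μ := Measure.pi fun i : Fin d => gaussianReal (θ i) (ε ^ 2).toNNReal
  set N := ∑ i, |θ i| ^ γ
  set I : ℝ := if 1 < γ then 1 else 0 with hI
  set T₁ := ε ^ (2 * γ) * (s : ℝ) ^ 2 * L ^ γ with hT₁
  set T₂ := ε ^ 2 * (s : ℝ) ^ (2 / γ) * (N ^ (1 / γ)) ^ (2 * γ - 2) * I with hT₂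
  have hI0 : 0 ≤ I := by rw [hI]; split_ifs <;> norm_num
  have hN0 : 0 ≤ N := Finset.sum_nonneg fun i _ => by positivity
  have hT₁0 : 0 ≤ T₁ := by
    have : 0 ≤ L := by linarith
    positivity
  have hT₂0 : 0 ≤ T₂ := by positivity
  have hsupp : ∫ y, (∑ i ∈ S, g i (y i)) ^ 2 ∂μ ≤ K₃ * (2 * (2 ^ γ * T₁ + T₂)) := by
    refine (integral_pi_sum_sq_le S (a := fun i => thresholdScale γ ε τ (θ i))
      (fun i => thresholdScale_pos hε hτ0 (θ i)) hg
      (fun i => (hcoord ε α τ hε hτ hα0 hαK (θ i)).2)).trans ?_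
    refine mul_le_mul_of_nonneg_left ?_ hK₃.le
    have hsplit : ∑ i ∈ S, thresholdScale γ ε τ (θ i) =
        S.card * (ε ^ γ * τ ^ γ) + ε * (∑ i ∈ S, |θ i| ^ (γ - 1)) * I := by
      simp only [thresholdScale]
      rw [Finset.sum_add_distrib, Finset.sum_const, nsmul_eq_mul, ← Finset.sum_mul,
        ← Finset.mul_sum]
    have hcard : (S.card : ℝ) ≤ s := by exact_mod_cast hθ
    rw [hsplit]
    refine add_sq_le.trans (mul_le_mul_of_nonneg_left (add_le_add ?_ ?_) zero_le_two)
    · calc (S.card * (ε ^ γ * τ ^ γ)) ^ 2 ≤ (s * (ε ^ γ * τ ^ γ)) ^ 2 :=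
            pow_le_pow_left₀ (mul_nonneg (Nat.cast_nonneg _) (by positivity))
              (mul_le_mul_of_nonneg_right hcard (by positivity)) 2
        _ = ε ^ (γ * 2) * s ^ 2 * τ ^ (γ * 2) := by
            rw [rpow_mul hε.le, rpow_mul hτ0.le, rpow_two, rpow_two]
            ring
        _ = 2 ^ γ * T₁ := by rw [mul_comm γ 2, hτγ, hT₁]; ring
    · by_cases h : 1 < γ
      · have := sum_abs_rpow_sub_one_sq_le h θ S hcard
        simp only [hT₂, hI, h, if_true, mul_one, mul_pow, mul_assoc]
        gcongr
      · simp [hT₂, hI, h]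
  have hnull : ∫ y, (∑ i ∈ Sᶜ, g i (y i)) ^ 2 ∂μ ≤ K₂ * (2 ^ γ * T₁) := by
    rw [integral_pi_sum_sq_of_integral_eq_zero Sᶜ hg fun i hi => by
      simp only [g, hzero i hi]
      exact integral_thresholdError_zero hγ hε hαP]
    have hterm : ∀ i ∈ Sᶜ, ∫ x, g i x ^ 2 ∂(gaussianReal (θ i) (ε ^ 2).toNNReal) ≤
        ε ^ (2 * γ) * (K₂ * (2 ^ γ * L ^ γ) * exp (-L)) := fun i hi => by
      simp only [g, hzero i hi]
      refine (integral_thresholdError_zero_sq_le hγ hε hαP).trans ?_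
      refine mul_le_mul_of_nonneg_left ((hmom τ hτ).trans_eq ?_) (by positivity)
      rw [hτγ, ← hτL]
      ring_nf
    refine (Finset.sum_le_card_nsmul _ _ _ hterm).trans ?_
    have hcard : ((Sᶜ).card : ℝ) ≤ d := by
      exact_mod_cast (Finset.card_le_univ Sᶜ).trans_eq (Fintype.card_fin d)
    have hLγ : 0 ≤ L ^ γ := rpow_nonneg (by linarith) γ
    rw [nsmul_eq_mul]
    calc _ ≤ d * (ε ^ (2 * γ) * (K₂ * (2 ^ γ * L ^ γ) * exp (-L))) := by gcongr
      _ = ε ^ (2 * γ) * (K₂ * (2 ^ γ * L ^ γ)) * (d * exp (-L)) := by ring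
      _ ≤ ε ^ (2 * γ) * (K₂ * (2 ^ γ * L ^ γ)) * (s : ℝ) ^ 2 := by gcongr
      _ = _ := by rw [hT₁]; ring
  have hint : ∀ U : Finset (Fin d), Integrable (fun y => (∑ i ∈ U, g i (y i)) ^ 2) μ := fun U =>
    (memLp_finsetSum U fun i _ =>
      (hg i).comp_measurePreserving (measurePreserving_eval _ i)).integrable_sq
  have hpt : ∀ y : Fin d → ℝ, ((∑ i, (|y i| ^ γ - ε ^ γ * α) *
      (if 2 * ε ^ 2 * L < (y i) ^ 2 then (1 : ℝ) else 0)) - N) ^ 2 ≤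
      2 * ((∑ i ∈ S, g i (y i)) ^ 2 + (∑ i ∈ Sᶜ, g i (y i)) ^ 2) := by
    intro y
    have h : (∑ i, (|y i| ^ γ - ε ^ γ * α) *
        (if 2 * ε ^ 2 * L < (y i) ^ 2 then (1 : ℝ) else 0)) - N = ∑ i, g i (y i) := by
      rw [← Finset.sum_sub_distrib]
      simp only [g, thresholdError, ← hτL, mul_left_comm (ε ^ 2) 2 L, mul_assoc]
    rw [h, ← Finset.sum_add_sum_compl S]
    exact add_sq_le
  calc _ ≤ ∫ y, 2 * ((∑ i ∈ S, g i (y i)) ^ 2 + (∑ i ∈ Sᶜ, g i (y i)) ^ 2) ∂μ :=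
        integral_mono_of_nonneg (ae_of_all _ fun y => sq_nonneg _)
          (((hint S).add (hint Sᶜ)).const_mul 2) (ae_of_all _ hpt)
    _ = 2 * (∫ y, (∑ i ∈ S, g i (y i)) ^ 2 ∂μ + ∫ y, (∑ i ∈ Sᶜ, g i (y i)) ^ 2 ∂μ) := by
        rw [integral_const_mul, integral_add (hint S) (hint Sᶜ)]
    _ ≤ 2 * (K₃ * (2 * (2 ^ γ * T₁ + T₂)) + K₂ * (2 ^ γ * T₁)) := by gcongr
    _ ≤ _ := by
        have h1 : 0 ≤ 2 ^ γ * (K₃ * T₂) := by positivity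
        have h2 : 0 ≤ 2 ^ γ * (K₂ * T₂) := by positivity
        have h3 : 0 ≤ K₃ * T₁ := by positivity
        linarith
end

section
/- Let γ > 0, let d, s be integers with 1 ≤ s ≤ d, let ε > 0, and let ℓ be any loss function in the class L. Then there exist positive constants c₁ and c₂ depending only on γ and ℓ such that, with φ = ε^γ s (log(1 + d/s²))^{γ/2}, the infimum over all Borel measurable estimators T̂ : ℝ^d → ℝ of the supremum over θ ∈ B_0(s) with ‖θ‖_γ ≤ φ^{1/γ} of E_θ[ ℓ( c₁ φ^{−1} |T̂(y) − N_γ(θ)| ) ] is at least c₂. -/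
open MeasureTheory ProbabilityTheory Real

open scoped ENNReal NNReal

/-- The Lebesgue integral of a product of functions of separate coordinates factorizes. -/
lemma lintegral_pi_prod_eq_prod {ι : Type*} [Fintype ι] (μ : ι → Measure ℝ)
    [∀ i, IsProbabilityMeasure (μ i)] {f : ι → ℝ → ℝ≥0∞} (hf : ∀ i, Measurable (f i)) :
    ∫⁻ y, ∏ i, f i (y i) ∂Measure.pi μ = ∏ i, ∫⁻ x, f i x ∂μ i := by
  have h := lintegral_prod_eq_prod_lintegral_of_indepFun Finset.univ
    (fun i (y : ι → ℝ) => f i (y i))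
    (iIndepFun_pi (μ := μ) (X := f) fun i => (hf i).aemeasurable)
    (fun i => (hf i).comp (measurable_pi_apply i))
  rw [h]
  refine Finset.prod_congr rfl fun i _ => ?_
  exact (measurePreserving_eval μ i).lintegral_comp (hf i)

/-- A product of probability measures with densities has the product density. -/
lemma pi_withDensity_prod {ι : Type*} [Fintype ι] (μ : ι → Measure ℝ)
    [∀ i, IsProbabilityMeasure (μ i)] {f : ι → ℝ → ℝ≥0∞} (hf : ∀ i, Measurable (f i))
    [∀ i, SigmaFinite ((μ i).withDensity (f i))] :
    Measure.pi (fun i => (μ i).withDensity (f i)) =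
      (Measure.pi μ).withDensity fun y => ∏ i, f i (y i) := by
  refine Measure.pi_eq fun t ht => ?_
  have hpi : MeasurableSet (Set.univ.pi t) := MeasurableSet.univ_pi ht
  rw [withDensity_apply _ hpi, ← lintegral_indicator hpi]
  have : ∀ y : ι → ℝ, (Set.univ.pi t).indicator (fun y => ∏ i, f i (y i)) y =
      ∏ i, (t i).indicator (f i) (y i) := by
    intro y
    by_cases hy : y ∈ Set.univ.pi t
    · rw [Set.indicator_of_mem hy]
      exact Finset.prod_congr rfl fun i _ =>
        (Set.indicator_of_mem (hy i (Set.mem_univ i)) _).symm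
    · rw [Set.indicator_of_notMem hy]
      simp only [Set.mem_pi, Set.mem_univ, true_implies, not_forall] at hy
      obtain ⟨i, hi⟩ := hy
      exact (Finset.prod_eq_zero (Finset.mem_univ i) (Set.indicator_of_notMem hi _)).symm
  simp_rw [this]
  rw [lintegral_pi_prod_eq_prod μ fun i => (hf i).indicator (ht i)]
  refine Finset.prod_congr rfl fun i _ => ?_
  rw [lintegral_indicator (ht i), withDensity_apply _ (ht i)]

/-- The density of `N(m, v)` with respect to `N(0, v)`. -/
noncomputable def gaussianShiftDensity (v : ℝ≥0) (m x : ℝ) : ℝ≥0∞ :=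
  ENNReal.ofReal (Real.exp (m * x / v - m ^ 2 / (2 * v)))

lemma measurable_gaussianShiftDensity (v : ℝ≥0) (m : ℝ) :
    Measurable (gaussianShiftDensity v m) := by
  unfold gaussianShiftDensity
  fun_prop

lemma gaussianReal_eq_withDensity_gaussianShiftDensity {v : ℝ≥0} (hv : v ≠ 0) (m : ℝ) :
    gaussianReal m v = (gaussianReal 0 v).withDensity (gaussianShiftDensity v m) := by
  rw [gaussianReal_of_var_ne_zero _ hv, gaussianReal_of_var_ne_zero _ hv,
    ← withDensity_mul _ (measurable_gaussianPDF 0 v) (measurable_gaussianShiftDensity v m)]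
  congr 1
  funext x
  have hv' : (v : ℝ) ≠ 0 := by exact_mod_cast hv
  rw [Pi.mul_apply, gaussianPDF, gaussianPDF, gaussianShiftDensity,
    ← ENNReal.ofReal_mul (gaussianPDFReal_nonneg 0 v x), gaussianPDFReal, gaussianPDFReal,
    mul_assoc (√(2 * π * v))⁻¹, ← Real.exp_add]
  congr 3
  field_simp
  ring

lemma gaussianShiftDensity_mul {v : ℝ≥0} (hv : v ≠ 0) (a b x : ℝ) :
    gaussianShiftDensity v a x * gaussianShiftDensity v b x =
      ENNReal.ofReal (Real.exp (a * b / v)) * gaussianShiftDensity v (a + b) x := by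
  have hv' : (v : ℝ) ≠ 0 := by exact_mod_cast hv
  unfold gaussianShiftDensity
  rw [← ENNReal.ofReal_mul (Real.exp_nonneg _), ← ENNReal.ofReal_mul (Real.exp_nonneg _),
    ← Real.exp_add, ← Real.exp_add]
  congr 2
  field_simp
  ring

lemma lintegral_gaussianShiftDensity_mul {v : ℝ≥0} (hv : v ≠ 0) (a b : ℝ) :
    ∫⁻ x, gaussianShiftDensity v a x * gaussianShiftDensity v b x ∂gaussianReal 0 v =
      ENNReal.ofReal (Real.exp (a * b / v)) := by
  simp_rw [gaussianShiftDensity_mul hv]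
  rw [lintegral_const_mul _ (measurable_gaussianShiftDensity v _)]
  have h : (gaussianReal (a + b) v) Set.univ = 1 := measure_univ
  rw [gaussianReal_eq_withDensity_gaussianShiftDensity hv, withDensity_apply _ .univ,
    Measure.restrict_univ] at h
  rw [h, mul_one]

lemma pi_gaussianReal_eq_withDensity {ι : Type*} [Fintype ι] {v : ℝ≥0} (hv : v ≠ 0)
    (θ : ι → ℝ) :
    Measure.pi (fun i => gaussianReal (θ i) v) =
      (Measure.pi fun _ : ι => gaussianReal 0 v).withDensity
        fun y => ∏ i, gaussianShiftDensity v (θ i) (y i) := by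
  have h : ∀ i, (gaussianReal 0 v).withDensity (gaussianShiftDensity v (θ i)) =
      gaussianReal (θ i) v :=
    fun i => (gaussianReal_eq_withDensity_gaussianShiftDensity hv (θ i)).symm
  have : ∀ i, SigmaFinite ((gaussianReal 0 v).withDensity (gaussianShiftDensity v (θ i))) :=
    fun i => by rw [h i]; infer_instance
  rw [← pi_withDensity_prod (fun _ : ι => gaussianReal 0 v)
    fun i => measurable_gaussianShiftDensity v (θ i)]
  simp_rw [h]

lemma lintegral_prod_gaussianShiftDensity_mul {ι : Type*} [Fintype ι] {v : ℝ≥0} (hv : v ≠ 0)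
    (θ η : ι → ℝ) :
    ∫⁻ y, (∏ i, gaussianShiftDensity v (θ i) (y i)) * ∏ i, gaussianShiftDensity v (η i) (y i)
        ∂(Measure.pi fun _ : ι => gaussianReal 0 v) =
      ∏ i, ENNReal.ofReal (Real.exp (θ i * η i / v)) := by
  simp_rw [← Finset.prod_mul_distrib]
  rw [lintegral_pi_prod_eq_prod (fun _ : ι => gaussianReal 0 v)
    (f := fun i x => gaussianShiftDensity v (θ i) x * gaussianShiftDensity v (η i) x)
    fun i => (measurable_gaussianShiftDensity v _).mul (measurable_gaussianShiftDensity v _)]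
  exact Finset.prod_congr rfl fun i _ => lintegral_gaussianShiftDensity_mul hv _ _

/-- Two-point lower bound between a simple hypothesis and a uniform mixture whose likelihood
ratio has second moment at most `8`. -/
lemma one_tenth_le_of_mixture {α ι : Type*} [MeasurableSpace α] [Fintype ι] [Nonempty ι]
    (μ : Measure α) (ν : ι → Measure α) [∀ i, IsProbabilityMeasure (ν i)]
    {L : ι → α → ℝ≥0∞} (hL : ∀ i, Measurable (L i)) (hν : ∀ i, ν i = μ.withDensity (L i))
    (hchi : ∑ i, ∑ j, ∫⁻ x, L i x * L j x ∂μ ≤ 8 * (Fintype.card ι : ℝ≥0∞) ^ 2)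
    {A : Set α} (hA : MeasurableSet A) {M : ℝ≥0∞} (h0 : μ A ≤ M) (h1 : ∀ i, ν i Aᶜ ≤ M) :
    ENNReal.ofReal (1 / 10) ≤ M := by
  set n : ℝ≥0∞ := (Fintype.card ι : ℝ≥0∞) with hn
  set S : α → ℝ≥0∞ := fun x => ∑ i, L i x with hS
  have hSm : Measurable S := Finset.measurable_fun_sum _ fun i _ => hL i
  have hLm : ∀ i j, Measurable fun x => L i x * L j x := fun i j => (hL i).mul (hL j)
  have hsum : n ≤ ∫⁻ x in A, S x ∂μ + n * M := by
    have h : ∀ i, (1 : ℝ≥0∞) ≤ ∫⁻ x in A, L i x ∂μ + M := fun i => by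
      rw [← withDensity_apply _ hA, ← hν i, ← measure_univ (μ := ν i),
        ← measure_add_measure_compl hA]
      gcongr
      exact h1 i
    calc n = ∑ _i : ι, (1 : ℝ≥0∞) := by simp [hn]
      _ ≤ ∑ i, (∫⁻ x in A, L i x ∂μ + M) := Finset.sum_le_sum fun i _ => h i
      _ = _ := by
        rw [Finset.sum_add_distrib, lintegral_finsetSum _ fun i _ => hL i]
        simp [hn]
  have hsq : ∫⁻ x, S x * S x ∂μ ≤ 8 * n ^ 2 := by
    refine le_trans (le_of_eq ?_) hchi
    simp_rw [hS, Finset.sum_mul_sum]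
    rw [lintegral_finsetSum _ fun i _ => Finset.measurable_fun_sum _ fun j _ => hLm i j]
    exact Finset.sum_congr rfl fun i _ => lintegral_finsetSum _ fun j _ => hLm i j
  have hn_top : n ≠ ∞ := by simp [hn]
  have hamgm : 16 * n * ∫⁻ x in A, S x ∂μ ≤ 8 * n ^ 2 + 64 * n ^ 2 * M := by
    calc 16 * n * ∫⁻ x in A, S x ∂μ = ∫⁻ x in A, 16 * n * S x ∂μ :=
          (lintegral_const_mul _ hSm).symm
      _ ≤ ∫⁻ x in A, (S x * S x + 64 * n ^ 2) ∂μ := by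
          refine lintegral_mono fun x => ?_
          generalize S x = z
          lift n to ℝ≥0 using hn_top with k
          induction z with
          | top => simp
          | coe z =>
            norm_cast
            rw [← NNReal.coe_le_coe]
            push_cast
            nlinarith [sq_nonneg ((z : ℝ) - 8 * k)]
      _ = ∫⁻ x in A, S x * S x ∂μ + 64 * n ^ 2 * μ A := by
          rw [lintegral_add_right _ measurable_const, setLIntegral_const]
      _ ≤ _ := by
          gcongr
          exact (setLIntegral_le_lintegral _ _).trans hsq
  have htot : 16 * n * n ≤ 8 * n ^ 2 + 80 * n ^ 2 * M := by
    calc 16 * n * n ≤ 16 * n * (∫⁻ x in A, S x ∂μ + n * M) := by gcongr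
      _ = 16 * n * ∫⁻ x in A, S x ∂μ + 16 * n ^ 2 * M := by ring
      _ ≤ 8 * n ^ 2 + 64 * n ^ 2 * M + 16 * n ^ 2 * M := by gcongr
      _ = _ := by ring
  have hpos : 0 < (Fintype.card ι : ℝ) := by exact_mod_cast Fintype.card_pos
  induction M with
  | top => simp
  | coe M =>
    rw [hn] at htot
    norm_cast at htot
    rw [← NNReal.coe_le_coe] at htot
    push_cast at htot
    refine ENNReal.ofReal_le_of_le_toReal ?_
    rw [ENNReal.coe_toReal]
    have : 0 < (Fintype.card ι : ℝ) ^ 2 := by positivity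
    nlinarith

/-- The vector equal to `a` at the selected position of each block `{j} × κ`, embedded through
`e`, and to `0` elsewhere. -/
noncomputable def blockSpike {σ κ ι : Type*} [DecidableEq κ] (e : σ × κ ↪ ι) (a : ℝ)
    (f : σ → κ) : ι → ℝ :=
  Function.extend e (fun p => if f p.1 = p.2 then a else 0) 0

section BlockSpike

variable {σ κ ι : Type*} [DecidableEq κ] [Fintype σ] [Fintype κ] [Fintype ι]

lemma sum_blockSpike {R : Type*} [AddCommMonoid R] (e : σ × κ ↪ ι) (a : ℝ) (f : σ → κ)
    {F : ℝ → R} (hF : F 0 = 0) :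
    ∑ k, F (blockSpike e a f k) = Fintype.card σ • F a := by
  rw [← Fintype.sum_of_injective e e.injective
    (fun p : σ × κ => F (if f p.1 = p.2 then a else 0)), Fintype.sum_prod_type]
  · simp_rw [apply_ite F, hF]
    simp
  · intro k hk
    rw [blockSpike, Function.extend_apply' _ _ _ hk, Pi.zero_apply, hF]
  · intro p
    rw [blockSpike, e.injective.extend_apply]

lemma prod_blockSpike_mul (e : σ × κ ↪ ι) (a v : ℝ) (f g : σ → κ) :
    ∏ k, ENNReal.ofReal (Real.exp (blockSpike e a f k * blockSpike e a g k / v)) =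
      ∏ j, if f j = g j then ENNReal.ofReal (Real.exp (a * a / v)) else 1 := by
  rw [← Fintype.prod_of_injective e e.injective
    (fun p : σ × κ => ENNReal.ofReal (Real.exp
      ((if f p.1 = p.2 then a else 0) * (if g p.1 = p.2 then a else 0) / v))),
    Fintype.prod_prod_type]
  · refine Finset.prod_congr rfl fun j _ => ?_
    rw [Finset.prod_eq_single (f j)]
    · by_cases h : f j = g j
      · simp [h]
      · simp [h, Ne.symm h]
    · intro l _ hl
      simp [Ne.symm hl]
    · simp
  · intro k hk
    rw [blockSpike, Function.extend_apply' _ _ _ hk]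
    simp
  · intro p
    simp only [blockSpike, e.injective.extend_apply]

end BlockSpike

lemma sum_prod_agree {σ κ : Type*} [DecidableEq κ] [Fintype σ] [DecidableEq σ] [Fintype κ]
    (f : σ → κ) (z : ℝ≥0∞) :
    ∑ g : σ → κ, ∏ j, (if f j = g j then 1 + z else 1) =
      (Fintype.card κ + z) ^ Fintype.card σ := by
  rw [← Fintype.prod_sum fun j l => if f j = l then 1 + z else 1]
  have h : ∀ j l, (if f j = l then 1 + z else 1) = 1 + if f j = l then z else 0 := by
    intro j l
    split_ifs <;> simp
  simp_rw [h, Finset.sum_add_distrib]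
  simp

lemma add_pow_le_eight_mul_pow {m s : ℕ} (hs : 0 < s) {z : ℝ} (hz0 : 0 ≤ z)
    (hz : z ≤ 2 * m / s) :
    ((m : ℝ≥0∞) + ENNReal.ofReal z) ^ s ≤ 8 * (m : ℝ≥0∞) ^ s := by
  have hs' : (0 : ℝ) < s := by exact_mod_cast hs
  have hreal : ((m : ℝ) + z) ^ s ≤ 8 * (m : ℝ) ^ s := by
    calc ((m : ℝ) + z) ^ s ≤ (m * (1 + 2 / s)) ^ s := by
          gcongr
          calc (m : ℝ) + z ≤ m + 2 * m / s := by gcongr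
            _ = _ := by ring
      _ = (1 + 2 / s) ^ s * (m : ℝ) ^ s := by rw [mul_pow, mul_comm]
      _ ≤ Real.exp (2 / s) ^ s * (m : ℝ) ^ s := by
          gcongr
          linarith [Real.add_one_le_exp (2 / (s : ℝ))]
      _ = Real.exp 1 ^ 2 * (m : ℝ) ^ s := by
          rw [← Real.exp_nat_mul, ← Real.exp_nat_mul]
          congr 2
          field_simp
          norm_num
      _ ≤ _ := by
          gcongr
          nlinarith [Real.exp_one_lt_d9, Real.exp_pos 1]
  have h := ENNReal.ofReal_le_ofReal hreal
  rw [ENNReal.ofReal_pow (by positivity), ENNReal.ofReal_add (by positivity) hz0,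
    ENNReal.ofReal_mul (by norm_num), ENNReal.ofReal_pow (by positivity),
    ENNReal.ofReal_natCast] at h
  simpa using h

lemma sum_sum_lintegral_blockSpike_le {d s m : ℕ} (hs : 0 < s) (hdm : d ≤ 2 * m * s)
    (e : Fin s × Fin m ↪ Fin d) {v : ℝ≥0} (hv : v ≠ 0) {a : ℝ}
    (ha : a * a / v = Real.log (1 + (d : ℝ) / (s : ℝ) ^ 2)) :
    ∑ f : Fin s → Fin m, ∑ g : Fin s → Fin m,
        ∫⁻ y, (∏ i, gaussianShiftDensity v (blockSpike e a f i) (y i)) *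
          ∏ i, gaussianShiftDensity v (blockSpike e a g i) (y i)
          ∂(Measure.pi fun _ : Fin d => gaussianReal 0 v) ≤
      8 * (Fintype.card (Fin s → Fin m) : ℝ≥0∞) ^ 2 := by
  have hs' : (0 : ℝ) < s := by exact_mod_cast hs
  have hz0 : (0 : ℝ) ≤ (d : ℝ) / (s : ℝ) ^ 2 := by positivity
  have hz : (d : ℝ) / (s : ℝ) ^ 2 ≤ 2 * m / s := by
    have : (d : ℝ) ≤ 2 * m * s := by exact_mod_cast hdm
    rw [div_le_div_iff₀ (by positivity) hs']
    nlinarith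
  simp_rw [lintegral_prod_gaussianShiftDensity_mul hv, prod_blockSpike_mul, ha,
    Real.exp_log (by positivity : (0 : ℝ) < 1 + (d : ℝ) / (s : ℝ) ^ 2),
    ENNReal.ofReal_add zero_le_one hz0, ENNReal.ofReal_one, sum_prod_agree]
  simp only [Fintype.card_fin, Finset.sum_const, Finset.card_univ, Fintype.card_pi,
    Finset.prod_const, nsmul_eq_mul, Nat.cast_pow]
  calc (m : ℝ≥0∞) ^ s * ((m : ℝ≥0∞) + ENNReal.ofReal ((d : ℝ) / (s : ℝ) ^ 2)) ^ s
      ≤ (m : ℝ≥0∞) ^ s * (8 * (m : ℝ≥0∞) ^ s) := by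
        gcongr
        exact add_pow_le_eight_mul_pow hs hz0 hz
    _ = _ := by ring

/-- If a function is at least `b` on a measurable set, its integral is at least `b` times the
measure of that set; the function need not be measurable. -/
lemma measure_le_lintegral_div {α : Type*} [MeasurableSpace α] {μ : Measure α} {A : Set α}
    (hA : MeasurableSet A) {F : α → ℝ≥0∞} {b : ℝ≥0∞} (hb0 : b ≠ 0) (hb : b ≠ ∞)
    (h : ∀ x ∈ A, b ≤ F x) : μ A ≤ (∫⁻ x, F x ∂μ) / b := by
  rw [ENNReal.le_div_iff_mul_le (Or.inl hb0) (Or.inl hb), mul_comm, ← setLIntegral_const]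
  exact (setLIntegral_mono' hA h).trans (setLIntegral_le_lintegral _ _)

/-- Theorem 6 (lower bound for estimating `N_γ(θ)` over `B_0(s) ∩ {‖θ‖_γ ≤ φ^{1/γ}}`).
For every `γ > 0` and every loss `ℓ` in the class `L` (nondecreasing on `[0,∞)`, `ℓ(0)=0`,
nonnegative and not identically zero on `[0,∞)`), there exist constants `c₁, c₂ > 0`
depending only on `γ` and `ℓ` such that for all integers `1 ≤ s ≤ d` and every `ε > 0`,
with `φ = ε^γ s log^{γ/2}(1+d/s²)`, every Borel measurable estimator `T̂` satisfies
`sup_{θ ∈ B_0(s), ‖θ‖_γ ≤ φ^{1/γ}} E_θ[ℓ(c₁ φ^{-1} |T̂(y) − N_γ(θ)|)] ≥ c₂`. -/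
theorem lower_bound_Ngamma_sparse (γ : ℝ) (hγ : 0 < γ) (ℓ : ℝ → ℝ)
    (hmono : ∀ x y : ℝ, 0 ≤ x → x ≤ y → ℓ x ≤ ℓ y) (hzero : ℓ 0 = 0)
    (hnonneg : ∀ x : ℝ, 0 ≤ x → 0 ≤ ℓ x) (hne : ∃ x : ℝ, 0 ≤ x ∧ ℓ x ≠ 0) :
    ∃ c₁ c₂ : ℝ, 0 < c₁ ∧ 0 < c₂ ∧
      ∀ d s : ℕ, 1 ≤ s → s ≤ d → ∀ ε : ℝ, 0 < ε →
        ∀ T : (Fin d → ℝ) → ℝ, Measurable T →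
          ENNReal.ofReal c₂ ≤
            ⨆ θ ∈ {θ : Fin d → ℝ | (Finset.univ.filter fun i => θ i ≠ 0).card ≤ s ∧
                (∑ i, |θ i| ^ γ) ^ (1 / γ) ≤
                  (ε ^ γ * s * Real.log (1 + (d : ℝ) / (s : ℝ) ^ 2) ^ (γ / 2)) ^ (1 / γ)},
              ∫⁻ y, ENNReal.ofReal
                  (ℓ (c₁ * (ε ^ γ * s * Real.log (1 + (d : ℝ) / (s : ℝ) ^ 2) ^ (γ / 2))⁻¹ *
                    |T y - ∑ i, |θ i| ^ γ|))
                ∂(Measure.pi fun i : Fin d => gaussianReal (θ i) (ε ^ 2).toNNReal) := by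
  obtain ⟨x₀, hx₀, hx₀ne⟩ := hne
  have hx₀pos : 0 < x₀ := hx₀.lt_of_ne fun h => hx₀ne (by rw [← h, hzero])
  have hb : 0 < ℓ x₀ := (hnonneg x₀ hx₀).lt_of_ne hx₀ne.symm
  refine ⟨2 * x₀, ℓ x₀ / 10, by positivity, by positivity, ?_⟩
  intro d s hs hsd ε hε T hT
  have hs' : (0 : ℝ) < s := by exact_mod_cast hs
  have hd' : (0 : ℝ) < d := by exact_mod_cast hs.trans hsd
  set lg : ℝ := Real.log (1 + (d : ℝ) / (s : ℝ) ^ 2) with hlg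
  have hlgpos : 0 < lg := Real.log_pos (by
    have : (0 : ℝ) < (d : ℝ) / (s : ℝ) ^ 2 := by positivity
    linarith)
  set φ : ℝ := ε ^ γ * s * lg ^ (γ / 2) with hφ
  have hφpos : 0 < φ := by positivity
  set v : ℝ≥0 := (ε ^ 2).toNNReal with hvdef
  have hvε : (v : ℝ) = ε ^ 2 := Real.coe_toNNReal _ (sq_nonneg ε)
  have hv : v ≠ 0 := by
    rw [← NNReal.coe_ne_zero, hvε]
    positivity
  set a : ℝ := ε * √lg with ha
  have hapos : 0 < a := by positivity
  have ha_sq : a * a / v = lg := by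
    rw [hvε, ha, mul_mul_mul_comm, Real.mul_self_sqrt hlgpos.le]
    field_simp
  have ha_pow : s * |a| ^ γ = φ := by
    rw [abs_of_pos hapos, ha, Real.mul_rpow hε.le (Real.sqrt_nonneg _), Real.sqrt_eq_rpow,
      ← Real.rpow_mul hlgpos.le, one_div_mul_eq_div, hφ]
    ring
  have hzero_pow : |(0 : ℝ)| ^ γ = 0 := by rw [abs_zero, Real.zero_rpow hγ.ne']
  let m : ℕ := d / s
  have hm : 0 < m := Nat.div_pos hsd hs
  have hdm : d ≤ 2 * m * s := by
    have h₁ : d < (m + 1) * s := Nat.lt_mul_of_div_lt (Nat.lt_succ_self _) hs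
    nlinarith
  have : Nonempty (Fin s → Fin m) := ⟨fun _ => ⟨0, hm⟩⟩
  let e : Fin s × Fin m ↪ Fin d :=
    finProdFinEquiv.toEmbedding.trans (Fin.castLEEmb (Nat.mul_div_le d s))
  have hN : ∀ f, ∑ i, |blockSpike e a f i| ^ γ = φ := fun f => by
    rw [sum_blockSpike e a f (F := fun x => |x| ^ γ) hzero_pow, Fintype.card_fin, nsmul_eq_mul,
      ha_pow]
  set Θ : Set (Fin d → ℝ) := {θ | (Finset.univ.filter fun i => θ i ≠ 0).card ≤ s ∧
    (∑ i, |θ i| ^ γ) ^ (1 / γ) ≤ φ ^ (1 / γ)} with hΘ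
  have h_spike : ∀ f, blockSpike e a f ∈ Θ := fun f => by
    refine ⟨?_, by rw [hN f]⟩
    rw [Finset.card_filter,
      sum_blockSpike e a f (F := fun x => if x ≠ 0 then 1 else 0) (by simp)]
    simp [hapos.ne']
  have h_null : (0 : Fin d → ℝ) ∈ Θ := by
    refine ⟨by simp, ?_⟩
    simp only [Pi.zero_apply, hzero_pow, Finset.sum_const_zero]
    rw [Real.zero_rpow (by positivity)]
    positivity
  have hloss : ∀ N t : ℝ, φ / 2 ≤ |t - N| →
      ENNReal.ofReal (ℓ x₀) ≤ ENNReal.ofReal (ℓ (2 * x₀ * φ⁻¹ * |t - N|)) := by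
    intro N t h
    refine ENNReal.ofReal_le_ofReal (hmono _ _ hx₀ ?_)
    calc x₀ = 2 * x₀ * φ⁻¹ * (φ / 2) := by field_simp
      _ ≤ _ := by gcongr
  set R : (Fin d → ℝ) → ℝ≥0∞ := fun θ => ∫⁻ y, ENNReal.ofReal
    (ℓ (2 * x₀ * φ⁻¹ * |T y - ∑ i, |θ i| ^ γ|))
      ∂(Measure.pi fun i : Fin d => gaussianReal (θ i) v) with hR
  change _ ≤ ⨆ θ ∈ Θ, R θ
  have hle : ∀ θ ∈ Θ, R θ ≤ ⨆ θ ∈ Θ, R θ := fun θ hθ => le_iSup₂ (f := fun θ _ => R θ) θ hθ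
  have hb0 : ENNReal.ofReal (ℓ x₀) ≠ 0 := (ENNReal.ofReal_pos.2 hb).ne'
  have hA : MeasurableSet {y | φ / 2 ≤ |T y|} := measurableSet_le measurable_const hT.abs
  have hkey := one_tenth_le_of_mixture (Measure.pi fun _ : Fin d => gaussianReal 0 v)
    (fun f : Fin s → Fin m => Measure.pi fun i => gaussianReal (blockSpike e a f i) v)
    (L := fun f y => ∏ i, gaussianShiftDensity v (blockSpike e a f i) (y i))
    (fun f => Finset.measurable_fun_prod _ fun i _ =>
      (measurable_gaussianShiftDensity v _).comp (measurable_pi_apply i))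
    (fun f => pi_gaussianReal_eq_withDensity hv _)
    (sum_sum_lintegral_blockSpike_le hs hdm e hv ha_sq) hA
    (M := (⨆ θ ∈ Θ, R θ) / ENNReal.ofReal (ℓ x₀))
    (by
      refine le_trans ?_ (ENNReal.div_le_div_right (hle 0 h_null) _)
      refine measure_le_lintegral_div hA hb0 ENNReal.ofReal_ne_top fun y hy => hloss _ _ ?_
      simpa [Real.zero_rpow hγ.ne'] using hy)
    (fun f => by
      refine le_trans ?_ (ENNReal.div_le_div_right (hle _ (h_spike f)) _)
      refine measure_le_lintegral_div hA.compl hb0 ENNReal.ofReal_ne_top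
        fun y hy => hloss _ _ ?_
      rw [hN f]
      have hy' : |T y| < φ / 2 := not_le.1 hy
      rw [abs_sub_comm]
      have := le_abs_self (φ - T y)
      have := le_abs_self (T y)
      linarith)
  rw [ENNReal.le_div_iff_mul_le (Or.inl hb0) (Or.inl ENNReal.ofReal_ne_top),
    ← ENNReal.ofReal_mul (by norm_num)] at hkey
  convert hkey using 2
  ring
end

section
/- Let γ > 1, let d, s be integers with 1 ≤ s ≤ d, let ε > 0, and let ℓ be any loss function in the class L. Then there exist positive constants c₁ and c₂ depending only on γ and ℓ such that the infimum over all Borel measurable estimators T̂ : ℝ^d → ℝ of the supremum over θ ∈ B_0(s) of E_θ[ ℓ( c₁ (ε s^{1/γ} (log(1 + d/s²))^{1/2})^{−1} |T̂(y) − ‖θ‖_γ| ) ] is at least c₂. -/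
open MeasureTheory ProbabilityTheory Real
open scoped NNReal ENNReal

namespace SparseNorm

/-- A product of measures with densities is the product measure with the product density. -/
lemma pi_withDensity {ι : Type*} [Fintype ι] {E : ι → Type*} [∀ i, MeasurableSpace (E i)]
    (μ : ∀ i, Measure (E i)) [∀ i, SigmaFinite (μ i)] (f : ∀ i, E i → ℝ)
    (hf : ∀ i, Integrable (f i) (μ i)) (hpos : ∀ i x, 0 ≤ f i x) :
    Measure.pi (fun i => (μ i).withDensity fun x => ENNReal.ofReal (f i x)) =
      (Measure.pi μ).withDensity fun y => ENNReal.ofReal (∏ i, f i (y i)) := by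
  have hfin : ∀ i, IsFiniteMeasure ((μ i).withDensity fun x => ENNReal.ofReal (f i x)) :=
    fun i => isFiniteMeasure_withDensity_ofReal (hf i).2
  refine Measure.pi_eq fun t ht => ?_
  rw [withDensity_apply _ (MeasurableSet.univ_pi ht), Measure.restrict_pi_pi,
    ← ofReal_integral_eq_lintegral_ofReal
      (Integrable.fintype_prod_dep fun i => (hf i).integrableOn)
      (ae_of_all _ fun y => Finset.prod_nonneg fun i _ => hpos i _),
    integral_fintype_prod_eq_prod,
    ENNReal.ofReal_prod_of_nonneg fun i _ => integral_nonneg (hpos i)]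
  refine Finset.prod_congr rfl fun i _ => ?_
  rw [withDensity_apply _ (ht i), ← ofReal_integral_eq_lintegral_ofReal (hf i).integrableOn
    (ae_of_all _ (hpos i))]

/-- The density of `N(a, v)` with respect to `N(0, v)`. -/
lemma gaussianReal_eq_withDensity_gaussianReal_zero (a : ℝ) {v : ℝ≥0} (hv : v ≠ 0) :
    gaussianReal a v = (gaussianReal 0 v).withDensity
      fun x => ENNReal.ofReal (exp (a / v * x - a ^ 2 / (2 * v))) := by
  have hv' : (v : ℝ) ≠ 0 := by exact_mod_cast hv
  rw [gaussianReal_of_var_ne_zero a hv, gaussianReal_of_var_ne_zero 0 hv,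
    ← withDensity_mul _ (measurable_gaussianPDF _ _) (by fun_prop)]
  congr 1
  ext x
  rw [Pi.mul_apply, gaussianPDF, gaussianPDF, ← ENNReal.ofReal_mul (gaussianPDFReal_nonneg _ _ _),
    gaussianPDFReal, gaussianPDFReal, mul_assoc _ (exp _) (exp _), ← exp_add]
  congr 3
  field_simp
  ring

/-- The likelihood ratio between `N(θ, v I)` and `N(0, v I)`. -/
noncomputable def likelihoodRatio {ι : Type*} [Fintype ι] (v : ℝ≥0) (θ y : ι → ℝ) : ℝ :=
  ∏ i, exp (θ i / v * y i - θ i ^ 2 / (2 * v))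

section

variable {ι : Type*} [Fintype ι] {v : ℝ≥0}

lemma likelihoodRatio_nonneg (θ y : ι → ℝ) : 0 ≤ likelihoodRatio v θ y :=
  Finset.prod_nonneg fun _ _ => (exp_pos _).le

lemma integrable_exp_affine_gaussianReal (t c : ℝ) :
    Integrable (fun x => exp (t * x - c)) (gaussianReal 0 v) := by
  simp_rw [exp_sub]
  exact (integrable_exp_mul_gaussianReal t).div_const _

lemma integral_exp_affine_gaussianReal (t c : ℝ) :
    ∫ x, exp (t * x - c) ∂(gaussianReal 0 v) = exp (v * t ^ 2 / 2 - c) := by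
  simp_rw [exp_sub]
  rw [integral_div]
  have h := congrFun (mgf_fun_id_gaussianReal (μ := 0) (v := v)) t
  simp only [mgf, zero_mul, zero_add] at h
  rw [h]

lemma pi_gaussianReal_eq_withDensity (hv : v ≠ 0) (θ : ι → ℝ) :
    Measure.pi (fun i => gaussianReal (θ i) v) =
      (Measure.pi fun _ : ι => gaussianReal 0 v).withDensity
        fun y => ENNReal.ofReal (likelihoodRatio v θ y) := by
  rw [funext fun i => gaussianReal_eq_withDensity_gaussianReal_zero (θ i) hv]
  exact pi_withDensity _ _ (fun i => integrable_exp_affine_gaussianReal _ _)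
    fun i x => (exp_pos _).le

lemma integrable_likelihoodRatio (θ : ι → ℝ) :
    Integrable (likelihoodRatio v θ) (Measure.pi fun _ : ι => gaussianReal 0 v) :=
  Integrable.fintype_prod fun i => integrable_exp_affine_gaussianReal (θ i / v) (θ i ^ 2 / (2 * v))

lemma measureReal_pi_gaussianReal (hv : v ≠ 0) (θ : ι → ℝ) {A : Set (ι → ℝ)}
    (hA : MeasurableSet A) :
    (Measure.pi fun i => gaussianReal (θ i) v).real A =
      ∫ y in A, likelihoodRatio v θ y ∂(Measure.pi fun _ : ι => gaussianReal 0 v) := by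
  rw [pi_gaussianReal_eq_withDensity hv, measureReal_def, withDensity_apply _ hA,
    ← ofReal_integral_eq_lintegral_ofReal (integrable_likelihoodRatio θ).integrableOn
      (ae_of_all _ (likelihoodRatio_nonneg θ)),
    ENNReal.toReal_ofReal (integral_nonneg (likelihoodRatio_nonneg θ))]

lemma likelihoodRatio_mul (θ η y : ι → ℝ) :
    likelihoodRatio v θ y * likelihoodRatio v η y =
      ∏ i, exp ((θ i + η i) / v * y i - (θ i ^ 2 + η i ^ 2) / (2 * v)) := by
  rw [likelihoodRatio, likelihoodRatio, ← Finset.prod_mul_distrib]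
  refine Finset.prod_congr rfl fun i _ => ?_
  rw [← exp_add]
  congr 1
  ring

lemma integrable_likelihoodRatio_mul (θ η : ι → ℝ) :
    Integrable (fun y => likelihoodRatio v θ y * likelihoodRatio v η y)
      (Measure.pi fun _ : ι => gaussianReal 0 v) := by
  simp_rw [likelihoodRatio_mul]
  exact Integrable.fintype_prod fun i =>
    integrable_exp_affine_gaussianReal ((θ i + η i) / v) ((θ i ^ 2 + η i ^ 2) / (2 * v))

lemma integral_likelihoodRatio_mul (hv : v ≠ 0) (θ η : ι → ℝ) :
    ∫ y, likelihoodRatio v θ y * likelihoodRatio v η y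
      ∂(Measure.pi fun _ : ι => gaussianReal 0 v) = exp ((∑ i, θ i * η i) / v) := by
  have hv' : (v : ℝ) ≠ 0 := by exact_mod_cast hv
  simp_rw [likelihoodRatio_mul]
  rw [integral_fintype_prod_eq_prod
    (fun i x => exp ((θ i + η i) / v * x - (θ i ^ 2 + η i ^ 2) / (2 * v))), Finset.sum_div, exp_sum]
  refine Finset.prod_congr rfl fun i _ => ?_
  rw [integral_exp_affine_gaussianReal]
  congr 1
  field_simp
  ring

end

/-- If the second moment of the average of the densities `L f` is at most `K`, then the averaged
mass of `A` is controlled by the mass of `A` under the base measure. -/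
lemma sum_setIntegral_le_of_second_moment {Ω F : Type*} [MeasurableSpace Ω] [Fintype F]
    {P : Measure Ω} [IsProbabilityMeasure P] {L : F → Ω → ℝ}
    (hL : ∀ f, Integrable (L f) P) (hLL : ∀ f g, Integrable (fun y => L f y * L g y) P)
    {K : ℝ} (hK : 0 < K)
    (hmom : ∀ f, ∑ g, ∫ y, L f y * L g y ∂P ≤ Fintype.card F * K)
    (A : Set Ω) :
    ∑ f, ∫ y in A, L f y ∂P ≤ Fintype.card F * (1 / 2 + K / 2 * P.real A) := by
  rcases isEmpty_or_nonempty F with hF | hF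
  · simp
  set N : ℝ := (Fintype.card F : ℝ) with hN
  have hNpos : 0 < N := by rw [hN]; exact_mod_cast Fintype.card_pos
  have hquad : ∀ z : ℝ, z ≤ (2 * K * N)⁻¹ * (z * z) + K * N / 2 := by
    intro z
    have h : (2 * K * N)⁻¹ * (z * z) + K * N / 2 - z = (2 * K * N)⁻¹ * (z - K * N) ^ 2 := by
      field_simp
      ring
    have : 0 ≤ (2 * K * N)⁻¹ * (z - K * N) ^ 2 := by positivity
    linarith
  have hsq : Integrable (fun y => (∑ f, L f y) * ∑ g, L g y) P := by
    simp_rw [Finset.sum_mul_sum]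
    exact integrable_finsetSum _ fun f _ => integrable_finsetSum _ fun g _ => hLL f g
  have hsq_le : ∫ y, (∑ f, L f y) * ∑ g, L g y ∂P ≤ N * (N * K) := by
    simp_rw [Finset.sum_mul_sum]
    rw [integral_finsetSum _ fun f _ => integrable_finsetSum _ fun g _ => hLL f g]
    calc _ = ∑ f, ∑ g, ∫ y, L f y * L g y ∂P :=
          Finset.sum_congr rfl fun f _ => integral_finsetSum _ fun g _ => hLL f g
      _ ≤ ∑ _f : F, N * K := Finset.sum_le_sum fun f _ => hmom f
      _ = N * (N * K) := by simp [hN]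
  have hc : 0 ≤ (2 * K * N)⁻¹ := by positivity
  calc ∑ f, ∫ y in A, L f y ∂P = ∫ y in A, ∑ f, L f y ∂P :=
        (integral_finsetSum _ fun f _ => (hL f).integrableOn).symm
    _ ≤ ∫ y in A, ((2 * K * N)⁻¹ * ((∑ f, L f y) * ∑ g, L g y) + K * N / 2) ∂P :=
        integral_mono (integrable_finsetSum _ fun f _ => (hL f).integrableOn)
          ((hsq.integrableOn.const_mul _).add (integrable_const _)) fun y => hquad _
    _ = (2 * K * N)⁻¹ * (∫ y in A, (∑ f, L f y) * ∑ g, L g y ∂P) + K * N / 2 * P.real A := by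
        rw [integral_add (hsq.integrableOn.const_mul _) (integrable_const _), integral_const_mul,
          setIntegral_const, smul_eq_mul, mul_comm (P.real A)]
    _ ≤ (2 * K * N)⁻¹ * (N * (N * K)) + K * N / 2 * P.real A := by
        gcongr
        exact (setIntegral_le_integral hsq (ae_of_all _ fun y => mul_self_nonneg _)).trans hsq_le
    _ = N * (1 / 2 + K / 2 * P.real A) := by
        field_simp

section

variable {d s m : ℕ}

/-- The vector with value `a` at one coordinate per block, the one selected by `f`, and `0`
elsewhere. -/
noncomputable def blockVector (e : Fin s × Fin m ↪ Fin d) (a : ℝ) (f : Fin s → Fin m) :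
    Fin d → ℝ :=
  fun i => ∑ j, if e (j, f j) = i then a else 0

lemma sum_comp_blockVector (e : Fin s × Fin m ↪ Fin d) (a : ℝ) (f : Fin s → Fin m)
    (φ : ℝ → ℝ) (c : Fin d → ℝ) (hφ : φ 0 = 0) :
    ∑ i, φ (blockVector e a f i) * c i = ∑ j, φ a * c (e (j, f j)) := by
  have h : ∀ i, φ (blockVector e a f i) * c i =
      ∑ j, if e (j, f j) = i then φ a * c (e (j, f j)) else 0 := by
    intro i
    by_cases hi : ∃ j, e (j, f j) = i
    · obtain ⟨j, rfl⟩ := hi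
      have hj : ∀ k, e (k, f k) = e (j, f j) ↔ k = j := fun k =>
        ⟨fun h => congrArg Prod.fst (e.injective h), fun h => by rw [h]⟩
      simp [blockVector, hj]
    · push Not at hi
      simp [blockVector, hi, hφ]
  rw [Finset.sum_congr rfl fun i _ => h i, Finset.sum_comm]
  simp

lemma card_support_blockVector_le (e : Fin s × Fin m ↪ Fin d) (a : ℝ) (f : Fin s → Fin m) :
    (Finset.univ.filter fun i => blockVector e a f i ≠ 0).card ≤ s := by
  calc _ ≤ (Finset.univ.image fun j => e (j, f j)).card := by
        refine Finset.card_le_card fun i hi => ?_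
        contrapose! hi
        simp only [Finset.mem_image, Finset.mem_univ, true_and, not_exists] at hi
        rw [Finset.mem_filter_univ, not_not]
        simp [blockVector, hi]
    _ ≤ s := Finset.card_image_le.trans (by simp)

lemma sum_abs_rpow_blockVector (e : Fin s × Fin m ↪ Fin d) {a γ : ℝ} (hγ : γ ≠ 0)
    (f : Fin s → Fin m) :
    ∑ i, |blockVector e a f i| ^ γ = s * |a| ^ γ := by
  simpa using sum_comp_blockVector e a f (fun x => |x| ^ γ) 1 (by simp [hγ])

lemma sum_blockVector_mul (e : Fin s × Fin m ↪ Fin d) (a : ℝ) (f g : Fin s → Fin m) :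
    ∑ i, blockVector e a f i * blockVector e a g i = ∑ j, if f j = g j then a ^ 2 else 0 := by
  have h := sum_comp_blockVector e a f id (blockVector e a g) rfl
  simp only [id] at h
  rw [h]
  refine Finset.sum_congr rfl fun j _ => ?_
  have hj : ∀ k, e (k, g k) = e (j, f j) ↔ k = j ∧ f j = g j := by
    intro k
    rw [e.injective.eq_iff, Prod.ext_iff]
    constructor
    · rintro ⟨rfl, h⟩
      exact ⟨rfl, h.symm⟩
    · rintro ⟨rfl, h⟩
      exact ⟨rfl, h.symm⟩
  simp [blockVector, hj, ite_and, pow_two]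

lemma sum_exp_inner_blockVector (e : Fin s × Fin m ↪ Fin d) (a v : ℝ) (f : Fin s → Fin m) :
    ∑ g, exp ((∑ i, blockVector e a f i * blockVector e a g i) / v) =
      (m - 1 + exp (a ^ 2 / v)) ^ s := by
  have h : ∀ g : Fin s → Fin m,
      exp ((∑ i, blockVector e a f i * blockVector e a g i) / v) =
        ∏ j, if f j = g j then exp (a ^ 2 / v) else 1 := by
    intro g
    rw [sum_blockVector_mul, Finset.sum_div, exp_sum]
    refine Finset.prod_congr rfl fun j _ => ?_
    split_ifs <;> simp
  rw [Finset.sum_congr rfl fun g _ => h g, ← Fintype.piFinset_univ,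
    Finset.sum_prod_piFinset Finset.univ fun j k => if f j = k then exp (a ^ 2 / v) else 1]
  have hsum : ∀ j, ∑ k, (if f j = k then exp (a ^ 2 / v) else 1) =
      (m - 1 + exp (a ^ 2 / v) : ℝ) := by
    intro j
    have : ∀ k, (if f j = k then exp (a ^ 2 / v) else 1) =
        1 + if f j = k then exp (a ^ 2 / v) - 1 else 0 := by
      intro k
      split_ifs <;> ring
    simp_rw [this, Finset.sum_add_distrib]
    simp
    ring
  simp [hsum]

end

/-- With blocks of size `d / s` and squared signal-to-noise ratio `log (1 + d / s²)`, the second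
moment of the averaged likelihood ratio is at most `8`. -/
lemma blockSize_second_moment_le {d s : ℕ} (hs : 1 ≤ s) (hsd : s ≤ d) :
    (((d / s : ℕ) : ℝ) - 1 + (1 + (d : ℝ) / (s : ℝ) ^ 2)) ^ s ≤ ((d / s : ℕ) : ℝ) ^ s * 8 := by
  set m := d / s with hm
  have hm1 : 1 ≤ m := (Nat.one_le_div_iff hs).2 hsd
  have hdm : d ≤ 2 * (m * s) := by
    have h1 := Nat.div_add_mod d s
    have h2 := Nat.mod_lt d hs
    rw [← hm] at h1
    nlinarith
  have hs' : (0 : ℝ) < s := by exact_mod_cast hs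
  have hm' : (0 : ℝ) < m := by exact_mod_cast hm1
  have hdm' : (d : ℝ) ≤ 2 * (m * s) := by exact_mod_cast hdm
  have hbase : (m : ℝ) - 1 + (1 + (d : ℝ) / (s : ℝ) ^ 2) ≤ m * exp (2 / s) := by
    have h1 : (d : ℝ) / (s : ℝ) ^ 2 ≤ m * (2 / s) := by
      rw [div_le_iff₀ (by positivity)]
      calc (d : ℝ) ≤ 2 * (m * s) := hdm'
        _ = m * (2 / s) * s ^ 2 := by field_simp
    have h2 : m * (2 / s + 1) ≤ m * exp (2 / s) :=
      mul_le_mul_of_nonneg_left (add_one_le_exp _) hm'.le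
    linarith
  calc _ ≤ (m * exp (2 / s)) ^ s := pow_le_pow_left₀ (by
        have : 0 ≤ (d : ℝ) / (s : ℝ) ^ 2 := by positivity
        linarith) hbase s
    _ = (m : ℝ) ^ s * exp 1 ^ 2 := by
        rw [mul_pow, ← exp_nat_mul, ← exp_nat_mul]
        congr 2
        push_cast
        field_simp
    _ ≤ (m : ℝ) ^ s * 8 := by
        gcongr
        have := exp_one_lt_d9
        nlinarith [exp_pos 1]

/-- Testing bound: no event separates `N(0, v I)` from all the shifts by block vectors. -/
lemma exists_blockVector_testing {d s : ℕ} (hs : 1 ≤ s) (hsd : s ≤ d) {v : ℝ≥0} (hv : v ≠ 0)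
    {a : ℝ} (ha : a ^ 2 / v = log (1 + (d : ℝ) / (s : ℝ) ^ 2))
    (e : Fin s × Fin (d / s) ↪ Fin d) {A : Set (Fin d → ℝ)} (hA : MeasurableSet A)
    (hA0 : (Measure.pi fun _ : Fin d => gaussianReal 0 v).real A < 1 / 10) :
    ∃ f, 1 / 10 ≤ (Measure.pi fun i => gaussianReal (blockVector e a f i) v).real Aᶜ := by
  by_contra! hcon
  have hmpos : 0 < d / s := Nat.div_pos hsd hs
  have : Nonempty (Fin s → Fin (d / s)) := ⟨fun _ => ⟨0, hmpos⟩⟩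
  have hN : (0 : ℝ) < Fintype.card (Fin s → Fin (d / s)) := by exact_mod_cast Fintype.card_pos
  have hlow : ∀ f ∈ Finset.univ, (9 / 10 : ℝ) ≤ ∫ y in A, likelihoodRatio v (blockVector e a f) y
      ∂(Measure.pi fun _ : Fin d => gaussianReal 0 v) := by
    intro f _
    rw [← measureReal_pi_gaussianReal hv _ hA]
    have h := hcon f
    rw [probReal_compl_eq_one_sub hA] at h
    linarith
  have hup := sum_setIntegral_le_of_second_moment (K := 8)
    (fun f => integrable_likelihoodRatio (v := v) (blockVector e a f))
    (fun f g => integrable_likelihoodRatio_mul (blockVector e a f) (blockVector e a g))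
    (by norm_num) (fun f => by
      simp_rw [integral_likelihoodRatio_mul hv]
      rw [sum_exp_inner_blockVector, ha, exp_log (by positivity)]
      simpa using blockSize_second_moment_le hs hsd) A
  have hsum := Finset.card_nsmul_le_sum _ _ _ hlow
  rw [Finset.card_univ, nsmul_eq_mul] at hsum
  have := le_of_mul_le_mul_left (hsum.trans hup) hN
  linarith

/-- A lower bound `c` on an event `A` bounds the integral below by `c` times the mass of `A`. -/
lemma ofReal_mul_measure_le_lintegral {Ω : Type*} [MeasurableSpace Ω] (P : Measure Ω)
    {h : Ω → ℝ} {c : ℝ} {A : Set Ω} (hA : MeasurableSet A) (hle : ∀ y ∈ A, c ≤ h y) :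
    ENNReal.ofReal c * P A ≤ ∫⁻ y, ENNReal.ofReal (h y) ∂P := by
  rw [← setLIntegral_const]
  exact (setLIntegral_mono' hA fun y hy => ENNReal.ofReal_le_ofReal (hle y hy)).trans
    (setLIntegral_le_lintegral _ _)

end SparseNorm

open SparseNorm in
/-- Theorem 7 (lower bound for estimating the `ℓ_γ`-norm over `B_0(s)`, `γ > 1`).
For every `γ > 1` and every loss `ℓ` in the class `L`, there exist constants
`c₁, c₂ > 0` depending only on `γ` and `ℓ` such that for all integers `1 ≤ s ≤ d` and
every `ε > 0`, every Borel measurable estimator `T̂` satisfies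
`sup_{θ ∈ B_0(s)} E_θ[ℓ(c₁ (ε s^{1/γ} log^{1/2}(1+d/s²))^{-1} |T̂(y) − ‖θ‖_γ|)] ≥ c₂`. -/
theorem lower_bound_norm_sparse (γ : ℝ) (hγ : 1 < γ) (ℓ : ℝ → ℝ)
    (hmono : ∀ x y : ℝ, 0 ≤ x → x ≤ y → ℓ x ≤ ℓ y) (hzero : ℓ 0 = 0)
    (hnonneg : ∀ x : ℝ, 0 ≤ x → 0 ≤ ℓ x) (hne : ∃ x : ℝ, 0 ≤ x ∧ ℓ x ≠ 0) :
    ∃ c₁ c₂ : ℝ, 0 < c₁ ∧ 0 < c₂ ∧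
      ∀ d s : ℕ, 1 ≤ s → s ≤ d → ∀ ε : ℝ, 0 < ε →
        ∀ T : (Fin d → ℝ) → ℝ, Measurable T →
          ENNReal.ofReal c₂ ≤
            ⨆ θ ∈ {θ : Fin d → ℝ | (Finset.univ.filter fun i => θ i ≠ 0).card ≤ s},
              ∫⁻ y, ENNReal.ofReal
                  (ℓ (c₁ * (ε * (s : ℝ) ^ (1 / γ) *
                      Real.log (1 + (d : ℝ) / (s : ℝ) ^ 2) ^ ((1 : ℝ) / 2))⁻¹ *
                    |T y - (∑ i, |θ i| ^ γ) ^ (1 / γ)|))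
                ∂(Measure.pi fun i : Fin d => gaussianReal (θ i) (ε ^ 2).toNNReal) := by
  obtain ⟨x₀, hx₀, hℓx₀⟩ := hne
  have hℓpos : 0 < ℓ x₀ := lt_of_le_of_ne (hnonneg _ hx₀) (Ne.symm hℓx₀)
  have hx₀pos : 0 < x₀ := lt_of_le_of_ne hx₀ fun h => hℓx₀ (by rw [← h, hzero])
  have hγ0 : γ ≠ 0 := by positivity
  refine ⟨2 * x₀, ℓ x₀ / 10, by positivity, by positivity, ?_⟩
  intro d s hs hsd ε hε T hT
  have hs' : (0 : ℝ) < s := by exact_mod_cast hs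
  have hd' : (0 : ℝ) < d := by exact_mod_cast hs.trans hsd
  have hlog : 0 < log (1 + (d : ℝ) / (s : ℝ) ^ 2) :=
    log_pos (by linarith [show 0 < (d : ℝ) / (s : ℝ) ^ 2 by positivity])
  set b := log (1 + (d : ℝ) / (s : ℝ) ^ 2) ^ ((1 : ℝ) / 2) with hb
  have hbpos : 0 < b := rpow_pos_of_pos hlog _
  have hbsq : b ^ 2 = log (1 + (d : ℝ) / (s : ℝ) ^ 2) := by
    rw [hb, ← rpow_natCast, ← rpow_mul hlog.le]
    norm_num
  set r := ε * (s : ℝ) ^ (1 / γ) * b with hr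
  have hrpos : 0 < r := by positivity
  have hv : (ε ^ 2).toNNReal ≠ 0 := by
    rw [Ne, Real.toNNReal_eq_zero]
    push Not
    positivity
  have hsnr : (ε * b) ^ 2 / ((ε ^ 2).toNNReal : ℝ) = log (1 + (d : ℝ) / (s : ℝ) ^ 2) := by
    rw [Real.coe_toNNReal _ (by positivity), ← hbsq]
    field_simp
  have hloss : ∀ t, r / 2 ≤ |t| → ℓ x₀ ≤ ℓ (2 * x₀ * r⁻¹ * |t|) := by
    intro t ht
    refine hmono _ _ hx₀ ?_
    calc x₀ = 2 * x₀ * r⁻¹ * (r / 2) := by field_simp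
      _ ≤ 2 * x₀ * r⁻¹ * |t| := by gcongr
  have hmain : ∀ (P : Measure (Fin d → ℝ)) [IsProbabilityMeasure P] (ρ : ℝ)
      (B : Set (Fin d → ℝ)), MeasurableSet B → (∀ y ∈ B, r / 2 ≤ |T y - ρ|) →
      1 / 10 ≤ P.real B →
      ENNReal.ofReal (ℓ x₀ / 10) ≤ ∫⁻ y, ENNReal.ofReal (ℓ (2 * x₀ * r⁻¹ * |T y - ρ|)) ∂P := by
    intro P _ ρ B hB hBle hPB
    refine le_trans ?_ (ofReal_mul_measure_le_lintegral P hB fun y hy => hloss _ (hBle y hy))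
    rw [← ofReal_measureReal, ← ENNReal.ofReal_mul hℓpos.le]
    refine ENNReal.ofReal_le_ofReal ?_
    nlinarith
  set A : Set (Fin d → ℝ) := {y | r / 2 ≤ T y} with hAdef
  have hA : MeasurableSet A := measurableSet_le measurable_const hT
  by_cases hA0 : 1 / 10 ≤ (Measure.pi fun _ : Fin d => gaussianReal 0 (ε ^ 2).toNNReal).real A
  · refine le_trans (hmain _ _ A hA ?_ hA0) (le_iSup₂_of_le (0 : Fin d → ℝ) (by simp) le_rfl)
    intro y hy
    simpa [hγ0] using le_abs.2 (Or.inl hy)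
  · have hcard : Fintype.card (Fin s × Fin (d / s)) ≤ Fintype.card (Fin d) := by
      simpa using Nat.mul_div_le d s
    obtain ⟨e⟩ := Function.Embedding.nonempty_of_card_le hcard
    obtain ⟨f, hf⟩ := exists_blockVector_testing hs hsd hv hsnr e hA (not_le.1 hA0)
    have hnorm : (∑ i, |blockVector e (ε * b) f i| ^ γ) ^ (1 / γ) = r := by
      rw [sum_abs_rpow_blockVector e hγ0, mul_rpow hs'.le (by positivity),
        ← rpow_mul (abs_nonneg _), mul_one_div_cancel hγ0, rpow_one,
        abs_of_pos (by positivity), hr]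
      ring
    refine le_trans (hmain _ _ Aᶜ hA.compl ?_ hf)
      (le_iSup₂_of_le (blockVector e (ε * b) f) (card_support_blockVector_le e _ f) le_rfl)
    intro y hy
    rw [hnorm]
    have hy' : T y < r / 2 := by simpa [hAdef] using hy
    rw [abs_sub_comm]
    exact le_abs.2 (Or.inl (by linarith))
end

section
/- Let H_k denote the k-th probabilists' Hermite polynomial, defined by H_k(x) = (−1)^k e^{x²/2} (d^k/dx^k) e^{−x²/2}. Let ϑ ∈ ℝ and let X be a random variable with distribution N(ϑ, 1). Then for every k ∈ ℕ, E[H_k(X)] = ϑ^k, and for every integer k ≥ 1, E[H_k(X)²] ≤ k^k (1 + ϑ²/k)^k. -/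
open MeasureTheory ProbabilityTheory Real Polynomial

lemma Polynomial.derivative_hermite_succ (n : ℕ) :
    derivative (hermite (n + 1)) = (n + 1 : ℤ[X]) * hermite n := by
  induction n with
  | zero => simp
  | succ n ih =>
    rw [hermite_succ (n + 1), derivative_sub, derivative_mul, ih, derivative_mul]
    simp only [derivative_X, derivative_add, derivative_natCast, derivative_one]
    push_cast
    linear_combination -(n + 1 : ℤ[X]) * hermite_succ n

lemma integrable_eval_gaussianReal (μ : ℝ) (v : NNReal) (p : ℝ[X]) :
    Integrable (fun x ↦ p.eval x) (gaussianReal μ v) := by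
  induction p using Polynomial.induction_on' with
  | add p q hp hq => simpa only [eval_add] using! hp.add hq
  | monomial n a =>
    simp only [eval_monomial]
    refine Integrable.const_mul ?_ a
    have h := (memLp_id_gaussianReal (μ := μ) (v := v) n).integrable_norm_pow'
    refine h.mono' (by fun_prop) (ae_of_all _ fun x ↦ by simp)

/-- Stein's identity for polynomials under the unit-variance Gaussian. -/
lemma integral_X_mul_gaussianReal (μ : ℝ) (p : ℝ[X]) :
    ∫ x, (X * p).eval x ∂(gaussianReal μ 1) =
      μ * ∫ x, p.eval x ∂(gaussianReal μ 1) +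
        ∫ x, (derivative p).eval x ∂(gaussianReal μ 1) := by
  have h_int : ∀ q : ℝ[X], Integrable (fun x ↦ gaussianPDFReal μ 1 x * q.eval x) := by
    intro q
    have h := integrable_eval_gaussianReal μ 1 q
    rw [gaussianReal_of_var_ne_zero _ one_ne_zero,
      integrable_withDensity_iff_integrable_smul₀' (by fun_prop)
        (ae_of_all _ fun x ↦ gaussianPDF_lt_top)] at h
    simpa [toReal_gaussianPDF] using h
  have hpdf : ∀ x, HasDerivAt (gaussianPDFReal μ 1) (-(x - μ) * gaussianPDFReal μ 1 x) x := by
    intro x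
    have h : HasDerivAt (fun x : ℝ ↦ -(x - μ) ^ 2 / (2 * 1)) (-(x - μ)) x := by
      refine (((((hasDerivAt_id x).sub_const μ).pow 2).neg).div_const (2 * 1)).congr_deriv ?_
      simp
      ring
    refine (h.exp.const_mul (√(2 * π * 1))⁻¹).congr_deriv ?_
    simp [gaussianPDFReal]
    ring
  have hzero := integral_eq_zero_of_hasDerivAt_of_integrable
    (f := fun x ↦ gaussianPDFReal μ 1 x * p.eval x)
    (f' := fun x ↦ gaussianPDFReal μ 1 x * (derivative p - (X - C μ) * p).eval x)
    (fun x ↦ ((hpdf x).mul (p.hasDerivAt x)).congr_deriv (by simp; ring)) (h_int _) (h_int _)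
  have hstein : ∫ x, (derivative p - (X - C μ) * p).eval x ∂(gaussianReal μ 1) = 0 := by
    rw [integral_gaussianReal_eq_integral_smul one_ne_zero]
    exact hzero
  have key : ∀ x : ℝ, (X * p).eval x =
      (derivative p).eval x + μ * p.eval x - (derivative p - (X - C μ) * p).eval x := by
    intro x; simp; ring
  have hI := integrable_eval_gaussianReal μ 1
  simp_rw [key]
  rw [integral_sub (by exact (hI _).add ((hI _).const_mul _)) (hI _),
    integral_add (hI _) ((hI _).const_mul _),
    integral_const_mul, hstein]
  ring

/-- Gaussian integration by parts lowers the degree of a Hermite polynomial. -/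
lemma integral_hermite_succ_mul_gaussianReal (μ : ℝ) (k : ℕ) (p : ℝ[X]) :
    ∫ x, aeval x (hermite (k + 1)) * p.eval x ∂(gaussianReal μ 1) =
      μ * ∫ x, aeval x (hermite k) * p.eval x ∂(gaussianReal μ 1) +
        ∫ x, aeval x (hermite k) * (derivative p).eval x ∂(gaussianReal μ 1) := by
  set q : ℝ[X] := (hermite k).map (algebraMap ℤ ℝ) with hq
  have h := integral_X_mul_gaussianReal μ (q * p)
  have hI := integrable_eval_gaussianReal μ 1
  have key : ∀ x : ℝ, aeval x (hermite (k + 1)) * p.eval x =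
      (X * (q * p)).eval x - (derivative q * p).eval x := by
    intro x
    simp [hermite_succ, hq, derivative_map, eval_map_algebraMap, -algebraMap_int_eq]
    ring
  have hk : ∀ (x : ℝ) (r : ℝ[X]), aeval x (hermite k) * r.eval x = (q * r).eval x := by
    intro x r
    simp [hq, eval_map_algebraMap, -algebraMap_int_eq]
  simp_rw [key, hk]
  rw [integral_sub (hI _) (hI _), h, derivative_mul]
  simp_rw [eval_add]
  rw [integral_add (hI _) (hI _)]
  ring

lemma integral_hermite_gaussianReal (μ : ℝ) (k : ℕ) :
    ∫ x, aeval x (hermite k) ∂(gaussianReal μ 1) = μ ^ k := by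
  induction k with
  | zero => simp
  | succ k ih =>
    have h := integral_hermite_succ_mul_gaussianReal μ k 1
    simp only [eval_one, mul_one, derivative_one, eval_zero, mul_zero, integral_zero,
      add_zero] at h
    rw [h, ih, pow_succ']

lemma integral_hermite_succ_mul_hermite_succ_gaussianReal (μ : ℝ) (k n : ℕ) :
    ∫ x, aeval x (hermite (k + 1)) * aeval x (hermite (n + 1)) ∂(gaussianReal μ 1) =
      μ * ∫ x, aeval x (hermite k) * aeval x (hermite (n + 1)) ∂(gaussianReal μ 1) +
        (n + 1) * ∫ x, aeval x (hermite k) * aeval x (hermite n) ∂(gaussianReal μ 1) := by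
  have h := integral_hermite_succ_mul_gaussianReal μ k
    ((hermite (n + 1)).map (algebraMap ℤ ℝ))
  simp only [derivative_map, derivative_hermite_succ, eval_map_algebraMap, map_mul, map_add,
    map_natCast, map_one] at h
  rw [h, ← integral_const_mul (n + 1 : ℝ)]
  congr 2
  ext x
  ring

lemma abs_integral_hermite_mul_hermite_gaussianReal_le (μ : ℝ) {N k m : ℕ} (h : m + k ≤ N) :
    |∫ x, aeval x (hermite k) * aeval x (hermite (m + k)) ∂(gaussianReal μ 1)| ≤
      |μ| ^ m * (N + μ ^ 2) ^ k := by
  induction k generalizing m with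
  | zero => simp [integral_hermite_gaussianReal]
  | succ k ih =>
    have h₁ := ih (m := m + 1) (by lia)
    have h₂ := ih (m := m) (by lia)
    have hN : ((m + k : ℕ) + 1 : ℝ) ≤ N := by exact_mod_cast h
    rw [← add_assoc, integral_hermite_succ_mul_hermite_succ_gaussianReal]
    rw [show m + 1 + k = m + k + 1 by ring] at h₁
    calc
      _ ≤ |μ| * (|μ| ^ (m + 1) * (N + μ ^ 2) ^ k) + N * (|μ| ^ m * (N + μ ^ 2) ^ k) := by
        refine (abs_add_le _ _).trans ?_
        rw [abs_mul, abs_mul, abs_of_nonneg (by positivity : (0 : ℝ) ≤ (m + k : ℕ) + 1)]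
        gcongr
      _ = |μ| ^ m * (N + μ ^ 2) ^ (k + 1) := by
        rw [← sq_abs μ]
        ring

/-- Lemma 2 (moments of Hermite polynomials of a Gaussian). Let `H_k` be the `k`-th
probabilists' Hermite polynomial (Mathlib's `Polynomial.hermite`, satisfying `H_0 = 1`,
`H_1 = X` and `H_{k+1}(x) = x H_k(x) − k H_{k-1}(x)`). If `X ~ N(ϑ, 1)` then
`E[H_k(X)] = ϑ^k` for every `k ∈ ℕ`, and `E[H_k(X)²] ≤ k^k (1 + ϑ²/k)^k` for every
integer `k ≥ 1`. -/
theorem hermite_gaussian_moments (ϑ : ℝ) :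
    (∀ k : ℕ, ∫ x, (Polynomial.aeval x) (Polynomial.hermite k) ∂(gaussianReal ϑ 1)
        = ϑ ^ k) ∧
      (∀ k : ℕ, 1 ≤ k →
        ∫ x, ((Polynomial.aeval x) (Polynomial.hermite k)) ^ 2 ∂(gaussianReal ϑ 1)
          ≤ (k : ℝ) ^ k * (1 + ϑ ^ 2 / k) ^ k) := by
  refine ⟨integral_hermite_gaussianReal ϑ, fun k hk ↦ ?_⟩
  have hk0 : (k : ℝ) ≠ 0 := by positivity
  have h := (le_abs_self _).trans
    (abs_integral_hermite_mul_hermite_gaussianReal_le ϑ (N := k) (k := k) (m := 0) (by simp))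
  simp only [zero_add, pow_zero, one_mul] at h
  simp_rw [sq (aeval _ _)]
  rwa [← mul_pow, mul_add, mul_one, mul_div_cancel₀ _ hk0]
end
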